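/- Let d ≥ 1 and let P₁,…,Pₙ be points in ℝᵈ whose affine span is all of ℝᵈ (i.e., the points are not contained in a hyperplane). For any integers r, r' with 1 ≤ r ≤ r' and r + r' ≤ d + 1, there exists an injective map ι : 𝓕ᵣ → 𝓕ᵣ' such that F ⊆ ι(F) for every F ∈ 𝓕ᵣ. -/

import Mathlib

/-- `W` is a flat determined by the points `P 0, …, P (n-1)`: a nonempty affine subspace
of `ℝᵈ` that equals the affine span of the set of points `P i` lying in `W`. -/
def IsFlatOf {n d : ℕ} (P : Fin n → (Fin d → ℝ)) (W : AffineSubspace ℝ (Fin d → ℝ)) : Prop :=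
  (W : Set (Fin d → ℝ)).Nonempty ∧ W = affineSpan ℝ (Set.range P ∩ (W : Set (Fin d → ℝ)))

/-- The rank of a flat: its dimension plus one. -/
noncomputable def flatRank {d : ℕ} (W : AffineSubspace ℝ (Fin d → ℝ)) : ℕ :=
  Module.finrank ℝ W.direction + 1

namespace TopHeavy
open Module

section Basics
variable {K V : Type} [Field K] [AddCommGroup V] [Module K V] [Finite V]

/-- The rank of a subspace. -/
noncomputable def rk (U : Submodule K V) : ℕ := finrank K U

/-- Adding a vector to a subspace. -/
def up (U : Submodule K V) (v : V) : Submodule K V := U ⊔ Submodule.span K {v}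

noncomputable instance : Fintype (Submodule K V) := Fintype.ofFinite _

theorem le_up (U : Submodule K V) (v : V) : U ≤ up U v := le_sup_left
theorem mem_up (U : Submodule K V) (v : V) : v ∈ up U v :=
  (le_sup_right : Submodule.span K {v} ≤ up U v) (Submodule.mem_span_singleton_self v)
theorem up_le {U W : Submodule K V} {v : V} (h : U ≤ W) (hv : v ∈ W) : up U v ≤ W :=
  sup_le h (by rwa [Submodule.span_singleton_le_iff_mem])
theorem up_eq_self {U : Submodule K V} {v : V} (hv : v ∈ U) : up U v = U :=
  le_antisymm (up_le le_rfl hv) (le_up _ _)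
theorem up_mono {U W : Submodule K V} (h : U ≤ W) (v : V) : up U v ≤ up W v :=
  sup_le_sup_right h _
theorem up_comm (U : Submodule K V) (u v : V) : up (up U u) v = up (up U v) u := by
  unfold up; rw [sup_right_comm]

theorem rk_mono {U W : Submodule K V} (h : U ≤ W) : rk U ≤ rk W :=
  Submodule.finrank_mono h
theorem rk_eq_of_le {U W : Submodule K V} (h : U ≤ W) (h2 : rk W ≤ rk U) : U = W :=
  Submodule.eq_of_le_of_finrank_le h h2
theorem rk_modular (U W : Submodule K V) : rk (U ⊔ W) + rk (U ⊓ W) = rk U + rk W :=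
  Submodule.finrank_sup_add_finrank_inf_eq U W
theorem rk_le (U : Submodule K V) : rk U ≤ finrank K V := Submodule.finrank_le U
theorem rk_top : rk (⊤ : Submodule K V) = finrank K V := finrank_top K V
theorem rk_bot : rk (⊥ : Submodule K V) = 0 := finrank_bot K V
theorem eq_top_of_rk {U : Submodule K V} (h : finrank K V ≤ rk U) : U = ⊤ :=
  rk_eq_of_le le_top (by rw [rk_top]; exact h)

theorem rk_up {U : Submodule K V} {v : V} (hv : v ∉ U) : rk (up U v) = rk U + 1 := by
  have h1 := rk_modular U (Submodule.span K {v})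
  have hv0 : v ≠ 0 := fun h => hv (h ▸ U.zero_mem)
  have h2 : rk (Submodule.span K {v}) = 1 := finrank_span_singleton hv0
  have h3 : U ⊓ Submodule.span K {v} = ⊥ := by
    rw [Submodule.eq_bot_iff]
    rintro x ⟨hx, hx2⟩
    obtain ⟨c, rfl⟩ := Submodule.mem_span_singleton.1 hx2
    by_contra hc
    have : c ≠ 0 := fun h => hc (by rw [h, zero_smul])
    exact hv ((U.smul_mem_iff this).1 hx)
  rw [h3, rk_bot, h2] at h1
  exact h1

theorem rk_up_le (U : Submodule K V) (v : V) : rk (up U v) ≤ rk U + 1 := by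
  by_cases hv : v ∈ U
  · rw [up_eq_self hv]; omega
  · rw [rk_up hv]

/-- exchange -/
theorem up_eq_of_mem {U : Submodule K V} {u v : V} (hu : u ∉ U) (h : u ∈ up U v) :
    up U u = up U v := by
  apply rk_eq_of_le (up_le (le_up _ _) h)
  rw [rk_up hu]; exact rk_up_le _ _

theorem not_mem_up_iff {U : Submodule K V} {u v : V} (hu : u ∉ U) (h : v ∉ up U u) :
    v ∉ U ∧ u ∉ up U v := by
  refine ⟨fun hv => h (le_up _ _ hv), fun h2 => h ?_⟩
  rw [up_eq_of_mem hu h2]; exact mem_up _ _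

theorem mem_iff_of_up_eq {F U : Submodule K V} {u v : V} (h : up F u = up F v) (hU : F ≤ U) :
    (u ∈ U ↔ v ∈ U) ∧ up U u = up U v := by
  have key : up U u = up U v := by
    have e : ∀ x, up U x = U ⊔ up F x := fun x => by
      unfold up; rw [← sup_assoc, sup_eq_left.2 hU]
    rw [e, e, h]
  refine ⟨⟨fun hu => ?_, fun hv => ?_⟩, key⟩
  · rw [up_eq_self hu] at key; rw [key]; exact mem_up _ _
  · rw [up_eq_self hv] at key; rw [← key]; exact mem_up _ _

open Classical in
/-- multiplication by the class of `v` in the graded Möbius algebra. -/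
noncomputable def mu (v : V) : (Submodule K V → ℝ) →ₗ[ℝ] (Submodule K V → ℝ) where
  toFun a := fun W => ∑ U, if v ∉ U ∧ up U v = W then a U else 0
  map_add' a b := by
    funext W
    simp only [Pi.add_apply, ← Finset.sum_add_distrib]
    exact Finset.sum_congr rfl fun U _ => by split_ifs <;> simp
  map_smul' c a := by
    funext W
    simp only [Pi.smul_apply, smul_eq_mul, RingHom.id_apply, Finset.mul_sum]
    exact Finset.sum_congr rfl fun U _ => by split_ifs <;> simp

open Classical in
/-- The basis element of a subspace. -/
noncomputable def ee (U : Submodule K V) : Submodule K V → ℝ := Pi.single U 1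

open Classical in
theorem mu_ee (v : V) (U : Submodule K V) :
    mu v (ee U) = if v ∈ U then 0 else ee (up U v) := by
  funext W
  simp only [mu, LinearMap.coe_mk, AddHom.coe_mk, ee]
  rw [Finset.sum_eq_single U]
  · by_cases hv : v ∈ U
    · simp [hv]
    · by_cases hW : up U v = W
      · subst hW; simp [hv]
      · simp [hv, hW, Pi.single_apply, Ne.symm hW]
  · intro U' _ hU'
    simp [Pi.single_apply, hU']
  · simp

theorem mu_ee_mem {v : V} {U : Submodule K V} (h : v ∈ U) : mu v (ee U) = 0 := by
  rw [mu_ee, if_pos h]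
theorem mu_ee_not_mem {v : V} {U : Submodule K V} (h : v ∉ U) : mu v (ee U) = ee (up U v) := by
  rw [mu_ee, if_neg h]

theorem eq_sum_ee (a : Submodule K V → ℝ) : a = ∑ U, a U • ee U := by
  classical
  funext W
  simp [ee, Finset.sum_apply, Pi.single_apply]

/-- graded pieces of the ideal generated by `F`. -/
def AF (F : Submodule K V) (w : ℕ) : Submodule ℝ (Submodule K V → ℝ) where
  carrier := {a | ∀ U, a U ≠ 0 → F ≤ U ∧ rk U = w}
  add_mem' {a b} ha hb U h := by
    by_cases h1 : a U = 0
    · exact hb U (by intro h2; apply h; simp [h1, h2])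
    · exact ha U h1
  zero_mem' := by intro U h; simp at h
  smul_mem' c a ha U h := ha U (by intro h2; apply h; simp [h2])

theorem ee_mem {F U : Submodule K V} (h : F ≤ U) : ee U ∈ AF F (rk U) := by
  classical
  intro W hW
  by_cases hWU : W = U
  · subst hWU; exact ⟨h, rfl⟩
  · simp [ee, Pi.single_apply, hWU] at hW

theorem ee_mem' {F U : Submodule K V} {w : ℕ} (h : F ≤ U) (hw : rk U = w) : ee U ∈ AF F w :=
  hw ▸ ee_mem h

/-- induction principle on `AF` -/
theorem AF_induction {F : Submodule K V} {w : ℕ} {M : Type} [AddCommGroup M] [Module ℝ M]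
    (f g : (Submodule K V → ℝ) →ₗ[ℝ] M)
    (h : ∀ U, F ≤ U → rk U = w → f (ee U) = g (ee U)) {a : Submodule K V → ℝ} (ha : a ∈ AF F w) :
    f a = g a := by
  rw [eq_sum_ee a, map_sum, map_sum]
  refine Finset.sum_congr rfl fun U _ => ?_
  rw [map_smul, map_smul]
  by_cases h0 : a U = 0
  · simp [h0]
  · rw [h U (ha U h0).1 (ha U h0).2]

theorem AF_mem_induction {F : Submodule K V} {w : ℕ} {P : Submodule ℝ (Submodule K V → ℝ)}
    (h : ∀ U, F ≤ U → rk U = w → ee U ∈ P) {a : Submodule K V → ℝ} (ha : a ∈ AF F w) : a ∈ P := by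
  rw [eq_sum_ee a]
  refine Submodule.sum_mem _ fun U _ => ?_
  by_cases h0 : a U = 0
  · simp [h0]
  · exact P.smul_mem _ (h U (ha U h0).1 (ha U h0).2)

theorem lin_ext {M : Type} [AddCommGroup M] [Module ℝ M]
    (f g : (Submodule K V → ℝ) →ₗ[ℝ] M) (h : ∀ U, f (ee U) = g (ee U)) : f = g := by
  refine LinearMap.ext fun a => ?_
  rw [eq_sum_ee a, map_sum, map_sum]
  exact Finset.sum_congr rfl fun U _ => by rw [map_smul, map_smul, h]

theorem mu_comm (u v : V) (a : Submodule K V → ℝ) : mu u (mu v a) = mu v (mu u a) := by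
  have : (mu (K := K) u) ∘ₗ (mu v) = (mu v) ∘ₗ (mu u) := by
    apply lin_ext
    intro U
    simp only [LinearMap.comp_apply]
    by_cases hu : u ∈ U
    · rw [mu_ee_mem hu, map_zero]
      by_cases hv : v ∈ U
      · rw [mu_ee_mem hv, map_zero]
      · rw [mu_ee_not_mem hv, mu_ee_mem (le_up _ _ hu)]
    · rw [mu_ee_not_mem hu]
      by_cases hv : v ∈ U
      · rw [mu_ee_mem hv, map_zero, mu_ee_mem (le_up _ _ hv)]
      · rw [mu_ee_not_mem hv]
        by_cases h : v ∈ up U u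
        · have h2 : up U v = up U u := up_eq_of_mem hv h
          rw [mu_ee_mem h, h2, mu_ee_mem (mem_up _ _)]
        · have h2 := (not_mem_up_iff hu h).2
          rw [mu_ee_not_mem h, mu_ee_not_mem h2, up_comm]
  exact congrArg (fun f => f a) this

theorem mu_mem {F : Submodule K V} {w : ℕ} {a : Submodule K V → ℝ} (v : V) (ha : a ∈ AF F w) :
    mu v a ∈ AF (up F v) (w + 1) := by
  refine AF_mem_induction (P := (AF (up F v) (w + 1)).comap (mu v)) ?_ ha
  intro U hU hw
  rw [Submodule.mem_comap]
  by_cases hv : v ∈ U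
  · rw [mu_ee_mem hv]; exact zero_mem _
  · rw [mu_ee_not_mem hv]; exact ee_mem' (up_mono hU v) (by rw [rk_up hv, hw])

theorem mu_eq_zero {F : Submodule K V} {w : ℕ} {a : Submodule K V → ℝ} {v : V} (hv : v ∈ F)
    (ha : a ∈ AF F w) : mu v a = 0 :=
  AF_induction (mu v) 0 (fun U hU _ => by rw [mu_ee_mem (hU hv)]; rfl) ha

theorem mu_congr {F : Submodule K V} {w : ℕ} {a : Submodule K V → ℝ} {u v : V}
    (h : up F u = up F v) (ha : a ∈ AF F w) : mu u a = mu v a := by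
  refine AF_induction (mu u) (mu v) (fun U hU _ => ?_) ha
  obtain ⟨h1, h2⟩ := mem_iff_of_up_eq h hU
  by_cases hu : u ∈ U
  · rw [mu_ee_mem hu, mu_ee_mem (h1.1 hu)]
  · rw [mu_ee_not_mem hu, mu_ee_not_mem (fun hv => hu (h1.2 hv)), h2]

theorem AF_mono {F G : Submodule K V} (h : F ≤ G) (w : ℕ) : AF G w ≤ AF F w :=
  fun _ ha U hU => ⟨h.trans (ha U hU).1, (ha U hU).2⟩

open Classical in
/-- The Poincaré pairing above `F`. -/
noncomputable def pp (F : Submodule K V) :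
    (Submodule K V → ℝ) →ₗ[ℝ] (Submodule K V → ℝ) →ₗ[ℝ] ℝ :=
  LinearMap.mk₂ ℝ (fun a b => ∑ U, ∑ W, if U ⊓ W = F ∧ U ⊔ W = ⊤ then a U * b W else 0)
    (by intro a a' b; simp only [← Finset.sum_add_distrib]
        refine Finset.sum_congr rfl fun U _ => Finset.sum_congr rfl fun W _ => ?_
        split_ifs <;> simp [add_mul])
    (by intro c a b; simp only [smul_eq_mul, Finset.mul_sum]
        refine Finset.sum_congr rfl fun U _ => Finset.sum_congr rfl fun W _ => ?_
        split_ifs <;> simp [mul_assoc])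
    (by intro a b b'; simp only [← Finset.sum_add_distrib]
        refine Finset.sum_congr rfl fun U _ => Finset.sum_congr rfl fun W _ => ?_
        split_ifs <;> simp [mul_add])
    (by intro c a b; simp only [smul_eq_mul, Finset.mul_sum]
        refine Finset.sum_congr rfl fun U _ => Finset.sum_congr rfl fun W _ => ?_
        split_ifs <;> simp [mul_left_comm])

open Classical in
theorem pp_ee (F U W : Submodule K V) :
    pp F (ee U) (ee W) = if U ⊓ W = F ∧ U ⊔ W = ⊤ then 1 else 0 := by
  simp only [pp, LinearMap.mk₂_apply, ee]
  rw [Finset.sum_eq_single U, Finset.sum_eq_single W]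
  · simp
  · intro W' _ h; simp [Pi.single_apply, h]
  · simp
  · intro U' _ h; simp [Pi.single_apply, h]
  · simp

theorem pp_symm (F : Submodule K V) (a b : Submodule K V → ℝ) : pp F a b = pp F b a := by
  simp only [pp, LinearMap.mk₂_apply]
  rw [Finset.sum_comm]
  refine Finset.sum_congr rfl fun U _ => Finset.sum_congr rfl fun W _ => ?_
  rw [inf_comm, sup_comm, mul_comm]

theorem adj_aux {F U W : Submodule K V} {v : V} (hv : v ∉ F) (hU : F ≤ U) (hW : up F v ≤ W) :
    (U ⊓ W = F ∧ U ⊔ W = ⊤) ↔ (v ∉ U ∧ up U v ⊓ W = up F v ∧ up U v ⊔ W = ⊤) := by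
  have hvW : v ∈ W := hW (mem_up _ _)
  have e1 : up U v ⊔ W = U ⊔ W := by
    unfold up
    rw [sup_assoc, sup_eq_right.2 (show Submodule.span K {v} ≤ W by
      rwa [Submodule.span_singleton_le_iff_mem])]
  have e2 : up U v ⊓ W = up (U ⊓ W) v := by
    unfold up
    rw [sup_comm U, sup_inf_assoc_of_le U (by rwa [Submodule.span_singleton_le_iff_mem]), sup_comm]
  rw [e1, e2]
  constructor
  · rintro ⟨h1, h2⟩
    refine ⟨fun h => hv (h1 ▸ ⟨h, hvW⟩), by rw [h1], h2⟩
  · rintro ⟨h0, h1, h2⟩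
    refine ⟨?_, h2⟩
    have h3 : v ∉ U ⊓ W := fun h => h0 h.1
    have h4 := rk_up h3
    rw [h1, rk_up hv] at h4
    exact (rk_eq_of_le (le_inf hU ((le_up _ _).trans hW)) (by omega)).symm

theorem pp_adj {F : Submodule K V} {v : V} (hv : v ∉ F) {w w' : ℕ} {a b : Submodule K V → ℝ}
    (ha : a ∈ AF F w) (hb : b ∈ AF (up F v) w') : pp F a b = pp (up F v) (mu v a) b := by
  refine AF_induction ((pp F).flip b) (((pp (up F v)).flip b) ∘ₗ (mu v)) (fun U hU _ => ?_) ha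
  simp only [LinearMap.flip_apply, LinearMap.comp_apply]
  refine AF_induction (pp F (ee U)) (pp (up F v) (mu v (ee U))) (fun W hW _ => ?_) hb
  have h := adj_aux hv hU hW
  by_cases hvU : v ∈ U
  · rw [mu_ee_mem hvU, pp_ee, map_zero, if_neg]
    · rfl
    · rw [h]; exact fun h' => h'.1 hvU
  · rw [mu_ee_not_mem hvU, pp_ee, pp_ee]
    simp only [h, hvU, not_false_eq_true, true_and]

open Classical in
/-- Lefschetz operator with weights. -/
noncomputable def Lc [Fintype V] (c : V → ℝ) : (Submodule K V → ℝ) →ₗ[ℝ] (Submodule K V → ℝ) :=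
  ∑ v, c v • mu v

variable [Fintype V]

theorem Lc_apply (c : V → ℝ) (a : Submodule K V → ℝ) : Lc c a = ∑ v, c v • mu v a := by
  simp [Lc]

theorem Lc_mu (c : V → ℝ) (v : V) (a : Submodule K V → ℝ) : Lc c (mu v a) = mu v (Lc c a) := by
  rw [Lc_apply, Lc_apply, map_sum]
  exact Finset.sum_congr rfl fun u _ => by rw [map_smul, mu_comm]

theorem Lpow_mu (c : V → ℝ) (v : V) (n : ℕ) (a : Submodule K V → ℝ) :
    (Lc c ^ n) (mu v a) = mu v ((Lc c ^ n) a) := by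
  induction n with
  | zero => rfl
  | succ n ih => rw [pow_succ', Module.End.mul_apply, ih, Lc_mu, Module.End.mul_apply]

theorem Lpow_succ (c : V → ℝ) (n : ℕ) (a : Submodule K V → ℝ) :
    (Lc c ^ (n+1)) a = Lc c ((Lc c ^ n) a) := by
  rw [pow_succ', Module.End.mul_apply]

theorem Lpow_succ' (c : V → ℝ) (n : ℕ) (a : Submodule K V → ℝ) :
    (Lc c ^ (n+1)) a = (Lc c ^ n) (Lc c a) := by
  rw [pow_succ, Module.End.mul_apply]

theorem AF_up_le (F : Submodule K V) (v : V) (w : ℕ) : AF (up F v) w ≤ AF F w :=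
  AF_mono (le_up _ _) w

theorem Lc_mem {c : V → ℝ} {F : Submodule K V} {w : ℕ} {a : Submodule K V → ℝ} (ha : a ∈ AF F w) :
    Lc c a ∈ AF F (w+1) := by
  rw [Lc_apply]
  exact Submodule.sum_mem _ fun v _ => Submodule.smul_mem _ _ (AF_up_le _ _ _ (mu_mem v ha))

theorem Lpow_mem {c : V → ℝ} {F : Submodule K V} {w : ℕ} {a : Submodule K V → ℝ} (n : ℕ)
    (ha : a ∈ AF F w) : (Lc c ^ n) a ∈ AF F (w+n) := by
  induction n with
  | zero => exact ha
  | succ n ih => rw [Lpow_succ]; exact Lc_mem ih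

theorem pp_mu {F : Submodule K V} {v : V} (hv : v ∉ F) {w w' : ℕ} {a b : Submodule K V → ℝ}
    (ha : a ∈ AF F w) (hb : b ∈ AF F w') : pp F (mu v a) b = pp (up F v) (mu v a) (mu v b) := by
  rw [pp_symm, pp_adj hv hb (mu_mem v ha), pp_symm]

theorem pp_mu_symm {F : Submodule K V} (v : V) {w w' : ℕ} {a b : Submodule K V → ℝ}
    (ha : a ∈ AF F w) (hb : b ∈ AF F w') : pp F (mu v a) b = pp F a (mu v b) := by
  by_cases hv : v ∈ F
  · rw [mu_eq_zero hv ha, mu_eq_zero hv hb]; simp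
  · rw [pp_mu hv ha hb, pp_adj hv ha (mu_mem v hb)]

theorem pp_Lc_symm {F : Submodule K V} (c : V → ℝ) {w w' : ℕ} {a b : Submodule K V → ℝ}
    (ha : a ∈ AF F w) (hb : b ∈ AF F w') : pp F (Lc c a) b = pp F a (Lc c b) := by
  rw [Lc_apply, Lc_apply, map_sum, map_sum, LinearMap.sum_apply]
  refine Finset.sum_congr rfl fun v _ => ?_
  rw [map_smul, map_smul, LinearMap.smul_apply, pp_mu_symm v ha hb]

theorem pp_Lpow_symm {F : Submodule K V} (c : V → ℝ) (n : ℕ) {w w' : ℕ}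
    {a b : Submodule K V → ℝ}
    (ha : a ∈ AF F w) (hb : b ∈ AF F w') : pp F ((Lc c ^ n) a) b = pp F a ((Lc c ^ n) b) := by
  induction n generalizing b w' with
  | zero => rfl
  | succ n ih =>
    rw [Lpow_succ, pp_Lc_symm c (Lpow_mem n ha) hb, ih (Lc_mem hb), Lpow_succ']

end Basics
end TopHeavy

namespace TopHeavy
open Module

section Path
variable {T X : Type} [TopologicalSpace T] [NormedAddCommGroup X] [NormedSpace ℝ X]
  [FiniteDimensional ℝ X]

theorem path_correct (E W : Submodule ℝ X) (B : T → X →ₗ[ℝ] X →ₗ[ℝ] ℝ) (L : T → X →ₗ[ℝ] X)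
    (hB : Continuous fun p : T × X × X => B p.1 p.2.1 p.2.2)
    (hL : Continuous fun p : T × X => L p.1 p.2)
    (hLW : ∀ t, ∀ u ∈ W, L t u ∈ E)
    (hsymm : ∀ t, ∀ x ∈ E, ∀ y ∈ E, B t x y = B t y x)
    (ndW : ∀ t, ∀ u ∈ W, (∀ u' ∈ W, B t (L t u) (L t u') = 0) → u = 0)
    (x : X) (hx : x ∈ E) :
    ∃ z : T → X, Continuous z ∧ (∀ t, z t ∈ W) ∧ (∀ t, ∀ u ∈ W, B t (x - L t (z t)) (L t u) = 0) ∧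
      ∀ t, (∀ u ∈ W, B t x (L t u) = 0) → z t = 0 := by
  classical
  let k := finrank ℝ W
  let b : Basis (Fin k) ℝ W := finBasis ℝ W
  let C : T → Matrix (Fin k) (Fin k) ℝ := fun t => Matrix.of fun i j => B t (L t (b i)) (L t (b j))
  have hC : Continuous C := by
    refine continuous_matrix fun i j => ?_
    have h1 : ∀ y : X, Continuous fun t => L t y := fun y => hL.comp (by fun_prop : Continuous fun t => (t, y))
    exact hB.comp (continuous_id.prodMk ((h1 _).prodMk (h1 _)))
  let β : T → Fin k → ℝ := fun t j => B t x (L t (b j))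
  have hβ : Continuous β := by
    refine continuous_pi fun j => ?_
    have h1 : ∀ y : X, Continuous fun t => L t y := fun y => hL.comp (by fun_prop : Continuous fun t => (t, y))
    exact hB.comp (continuous_id.prodMk (continuous_const.prodMk (h1 _)))
  have hsum : ∀ g : Fin k → ℝ, ∃ u ∈ W, u = ∑ i, g i • (b i : X) := fun g =>
    ⟨_, Submodule.sum_mem _ fun i _ => W.smul_mem _ (b i).2, rfl⟩
  have hdet : ∀ t, (C t).det ≠ 0 := by
    intro t h0
    obtain ⟨g, hg0, hg⟩ := Matrix.exists_vecMul_eq_zero_iff.2 h0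
    apply hg0
    have hu : ∑ i, g i • (b i : X) = 0 := by
      apply ndW t _ (Submodule.sum_mem _ fun i _ => W.smul_mem _ (b i).2)
      intro u' hu'
      have e := b.sum_repr ⟨u', hu'⟩
      have e' : u' = ∑ j, (b.repr ⟨u', hu'⟩ j) • (b j : X) := by
        have := congrArg (Submodule.subtype W) e
        rw [map_sum] at this
        exact this.symm
      rw [e']
      simp only [map_sum, map_smul, LinearMap.sum_apply, LinearMap.smul_apply]
      refine Finset.sum_eq_zero fun j _ => ?_
      have := congrFun hg j
      simp only [Matrix.vecMul, dotProduct, C, Matrix.of_apply, Pi.zero_apply] at this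
      simp only [smul_eq_mul]
      rw [this, mul_zero]
    have hli := b.linearIndependent
    have : ∑ i, g i • b i = 0 := by
      apply Subtype.ext
      simpa using hu
    funext i
    exact Fintype.linearIndependent_iff.1 hli g this i
  let γ : T → Fin k → ℝ := fun t => Matrix.mulVec ((C t).det⁻¹ • (C t).adjugate) (β t)
  have hγ : Continuous γ := by
    refine Continuous.matrix_mulVec ?_ hβ
    exact (hC.matrix_det.inv₀ hdet).smul hC.matrix_adjugate
  have hCγ : ∀ t, Matrix.mulVec (C t) (γ t) = β t := by
    intro t
    simp only [γ]
    rw [Matrix.mulVec_mulVec, Matrix.mul_smul, Matrix.mul_adjugate, smul_smul,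
      inv_mul_cancel₀ (hdet t), one_smul, Matrix.one_mulVec]
  refine ⟨fun t => ∑ i, γ t i • (b i : X), ?_, ?_, ?_, ?_⟩
  · exact continuous_finsetSum _ fun i _ => ((continuous_apply i).comp hγ).smul continuous_const
  · exact fun t => Submodule.sum_mem _ fun i _ => W.smul_mem _ (b i).2
  · intro t u' hu'
    have e := b.sum_repr ⟨u', hu'⟩
    have e' : u' = ∑ j, (b.repr ⟨u', hu'⟩ j) • (b j : X) := by
      have := congrArg (Submodule.subtype W) e
      rw [map_sum] at this
      exact this.symm
    rw [e']
    simp only [map_sum, map_smul]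
    refine Finset.sum_eq_zero fun j _ => ?_
    have h := congrFun (hCγ t) j
    simp only [Matrix.mulVec, dotProduct, C, Matrix.of_apply, β] at h
    rw [map_sub, LinearMap.sub_apply, ← h]
    simp only [map_sum, map_smul, LinearMap.sum_apply, LinearMap.smul_apply, smul_eq_mul]
    rw [← Finset.sum_sub_distrib]
    rw [Finset.sum_eq_zero, mul_zero]
    intro i _
    rw [hsymm t _ (hLW t _ (b j).2) _ (hLW t _ (b i).2)]
    ring
  · intro t ht
    have : β t = 0 := by funext j; exact ht _ (b j).2
    simp only [γ, this, Matrix.mulVec_zero]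
    simp

theorem semidef_zero {E : Submodule ℝ X} {B : X →ₗ[ℝ] X →ₗ[ℝ] ℝ} {ε : ℝ} {x y : X}
    (hε : ε ≠ 0) (hs : B x y = B y x) (h : ∀ s : ℝ, 0 ≤ ε * B (x + s • y) (x + s • y))
    (h0 : B x x = 0) : B x y = 0 := by
  have h1 : ∀ s : ℝ, 0 ≤ (ε * B y y) * (s * s) + (2 * ε * B x y) * s + 0 := by
    intro s
    have := h s
    simp only [map_add, map_smul, LinearMap.add_apply, LinearMap.smul_apply, smul_eq_mul] at this
    rw [← hs, h0] at this
    linarith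
  have h2 := discrim_le_zero h1
  unfold discrim at h2
  have h3 : 2 * ε * B x y = 0 := by nlinarith [sq_nonneg (2 * ε * B x y)]
  simpa [hε] using h3

theorem path_lemma [PreconnectedSpace T] (E W : Submodule ℝ X) (B : T → X →ₗ[ℝ] X →ₗ[ℝ] ℝ)
    (L : T → X →ₗ[ℝ] X)
    (hB : Continuous fun p : T × X × X => B p.1 p.2.1 p.2.2)
    (hL : Continuous fun p : T × X => L p.1 p.2)
    (hLW : ∀ t, ∀ u ∈ W, L t u ∈ E)
    (hsymm : ∀ t, ∀ x ∈ E, ∀ y ∈ E, B t x y = B t y x)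
    (ndE : ∀ t, ∀ x ∈ E, (∀ y ∈ E, B t x y = 0) → x = 0)
    (ndW : ∀ t, ∀ u ∈ W, (∀ u' ∈ W, B t (L t u) (L t u') = 0) → u = 0)
    (ε : ℝ) (hε : ε ≠ 0) (t₀ t₁ : T)
    (h₀ : ∀ x ∈ E, (∀ u ∈ W, B t₀ x (L t₀ u) = 0) → x ≠ 0 → 0 < ε * B t₀ x x) :
    ∀ x ∈ E, (∀ u ∈ W, B t₁ x (L t₁ u) = 0) → x ≠ 0 → 0 < ε * B t₁ x x := by
  let A : Set T := {t | ∀ x ∈ E, (∀ u ∈ W, B t x (L t u) = 0) → x ≠ 0 → 0 < ε * B t x x}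
  have hcor := fun x hx => path_correct E W B L hB hL hLW hsymm ndW x hx
  have hopen : IsClosed Aᶜ := by
    let Sph : Set X := Metric.sphere (0 : X) 1
    have : CompactSpace Sph := isCompact_iff_compactSpace.1 (isCompact_sphere _ _)
    let Z : Set (T × Sph) := {p | (p.2 : X) ∈ E ∧ (∀ u ∈ W, B p.1 p.2 (L p.1 u) = 0) ∧
      ε * B p.1 p.2 p.2 ≤ 0}
    have hZ : IsClosed Z := by
      refine IsClosed.inter ?_ (IsClosed.inter ?_ ?_)
      · exact (Submodule.closed_of_finiteDimensional E).preimage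
          (continuous_subtype_val.comp continuous_snd)
      · have : {p : T × Sph | ∀ u ∈ W, B p.1 p.2 (L p.1 u) = 0} =
            ⋂ u ∈ W, {p : T × Sph | B p.1 p.2 (L p.1 u) = 0} := by
          ext p; simp
        show IsClosed {p : T × Sph | ∀ u ∈ W, B p.1 p.2 (L p.1 u) = 0}
        rw [this]
        refine isClosed_biInter fun u _ => isClosed_eq ?_ continuous_const
        have h1 : Continuous fun p : T × Sph => L p.1 u :=
          hL.comp (continuous_fst.prodMk continuous_const)
        exact hB.comp (continuous_fst.prodMk
          ((continuous_subtype_val.comp continuous_snd).prodMk h1))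
      · refine isClosed_le (f := fun p : T × Sph => ε * B p.1 p.2 p.2) ?_ continuous_const
        refine continuous_const.mul ?_
        have h1 : Continuous fun p : T × Sph => (p.2 : X) :=
          continuous_subtype_val.comp continuous_snd
        exact hB.comp (continuous_fst.prodMk (h1.prodMk h1))
    have himg : Aᶜ = Prod.fst '' Z := by
      ext t
      constructor
      · intro ht
        simp only [A, Set.mem_compl_iff, Set.mem_ofPred_eq, not_forall, not_lt] at ht
        obtain ⟨x, hxE, hxp, hx0, hxB⟩ := ht
        have hn : ‖x‖ ≠ 0 := norm_ne_zero_iff.2 hx0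
        refine ⟨(t, ⟨‖x‖⁻¹ • x, ?_⟩), ⟨E.smul_mem _ hxE, ?_, ?_⟩, rfl⟩
        · simp [Sph, norm_smul, hn]
        · intro u hu
          simp [hxp u hu]
        · simp only [map_smul, LinearMap.smul_apply, smul_eq_mul]
          have : 0 ≤ ‖x‖⁻¹ * ‖x‖⁻¹ := by positivity
          nlinarith
      · rintro ⟨⟨t', x⟩, ⟨h1, h2, h3⟩, rfl⟩ hA
        have hx0 : (x : X) ≠ 0 := by
          intro h
          have := x.2
          simp [Sph, h] at this
        exact absurd (hA x h1 h2 hx0) (not_lt.2 h3)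
    rw [himg]
    exact isClosedMap_fst_of_compactSpace _ hZ
  have hclosed : IsClosed A := by
    rw [← closure_subset_iff_isClosed]
    intro t ht
    -- semidefinite
    have hsemi : ∀ x ∈ E, (∀ u ∈ W, B t x (L t u) = 0) → 0 ≤ ε * B t x x := by
      intro x hxE hxp
      obtain ⟨z, hz, hzW, hzp, hz0⟩ := hcor x hxE
      have hy : Continuous fun s => x - L s (z s) :=
        continuous_const.sub (hL.comp (continuous_id.prodMk hz))
      have hf : Continuous fun s => ε * B s (x - L s (z s)) (x - L s (z s)) :=
        continuous_const.mul (hB.comp (continuous_id.prodMk (hy.prodMk hy)))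
      have hcl : IsClosed {s | 0 ≤ ε * B s (x - L s (z s)) (x - L s (z s))} :=
        isClosed_le continuous_const hf
      have hsub : A ⊆ {s | 0 ≤ ε * B s (x - L s (z s)) (x - L s (z s))} := by
        intro s hs
        by_cases h0 : x - L s (z s) = 0
        · show 0 ≤ ε * B s (x - L s (z s)) (x - L s (z s))
          rw [h0]; simp
        · exact (hs _ (E.sub_mem hxE (hLW s _ (hzW s))) (hzp s) h0).le
      have := closure_minimal hsub hcl ht
      simpa [hz0 t hxp] using this
    intro x hxE hxp hx0
    refine lt_of_le_of_ne (hsemi x hxE hxp) fun h => hx0 (ndE t x hxE fun y hy => ?_)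
    have h0 : B t x x = 0 := by
      rcases mul_eq_zero.1 h.symm with h | h
      · exact absurd h hε
      · exact h
    obtain ⟨z, -, hzW, hzp, -⟩ := hcor y hy
    have hy' : y - L t (z t) ∈ E := E.sub_mem hy (hLW t _ (hzW t))
    have h1 : B t x (y - L t (z t)) = 0 := by
      refine semidef_zero (E := E) hε (hsymm t _ hxE _ hy') (fun s => ?_) h0
      refine hsemi _ (E.add_mem hxE (E.smul_mem _ hy')) fun u hu => ?_
      rw [map_add, map_smul, LinearMap.add_apply, LinearMap.smul_apply, hxp u hu, hzp t u hu]
      simp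
    have h2 := hxp _ (hzW t)
    rw [map_sub, h2, sub_zero] at h1
    exact h1
  have : A = Set.univ := IsClopen.eq_univ ⟨hclosed, isClosed_compl_iff.1 hopen⟩ ⟨t₀, h₀⟩
  have h := Set.mem_univ t₁
  rw [← this] at h
  exact h

end Path
end TopHeavy

namespace TopHeavy
open Module

section Systems
variable {K V : Type} [Field K] [AddCommGroup V] [Module K V] [Finite V] [Fintype V]

open Classical in
/-- indicator weights -/
noncomputable def ind (S : Finset V) (v : V) : ℝ := if v ∈ S then 1 else 0

/-- Hodge-Riemann relations for the space above `F`. -/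
def HR (N : Submodule K V → ℕ → Submodule ℝ (Submodule K V → ℝ)) (c : V → ℝ)
    (F : Submodule K V) : Prop :=
  ∀ w σ, 2 * w + σ = finrank K V + rk F → ∀ a ∈ N F w,
    (∀ w', w' + 1 = w → ∀ u ∈ N F w', pp F ((Lc c ^ (σ+1)) a) u = 0) → a ≠ 0 →
    0 < (-1 : ℝ) ^ (w + rk F) * pp F ((Lc c ^ σ) a) a

/-- The basic stability properties of a system. -/
structure Pre (S : Finset V) (N : Submodule K V → ℕ → Submodule ℝ (Submodule K V → ℝ)) : Prop where
  sub : ∀ F w, N F w ≤ AF F w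
  up : ∀ F w, ∀ s ∈ S, N (up F s) w ≤ N F w
  mul : ∀ F w, ∀ s ∈ S, ∀ a ∈ N F w, mu s a ∈ N (TopHeavy.up F s) (w + 1)

/-- The defining properties of a system. -/
structure Sys (S : Finset V) (N : Submodule K V → ℕ → Submodule ℝ (Submodule K V → ℝ)) : Prop
    extends Pre S N where
  span : Submodule.span K (S : Set V) = ⊤
  one : ∀ F, ee F ∈ N F (rk F)
  nd : ∀ F w w', w + w' = finrank K V + rk F → ∀ a ∈ N F w,
    (∀ b ∈ N F w', pp F a b = 0) → a = 0
  inj : ∀ F w, F ≠ ⊤ → 2 * w ≤ finrank K V + rk F → ∀ a ∈ N F w,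
    (∀ s ∈ S, mu s a = 0) → a = 0
  lim : ∀ F w, F ≠ ⊤ → ∀ g : V → (Submodule K V → ℝ),
    (∀ s ∈ S, s ∉ F → g s ∈ N (TopHeavy.up F s) (w + 1)) →
    (∀ s ∈ S, s ∉ F → ∀ t ∈ S, t ∉ F → TopHeavy.up F s = TopHeavy.up F t → g s = g t) →
    (∀ s ∈ S, s ∉ F → ∀ t ∈ S, t ∉ F → mu t (g s) = mu s (g t)) →
    ∃ a ∈ N F w, ∀ s ∈ S, s ∉ F → mu s a = g s
  hr : ∀ F, HR N (ind S) F

variable {S : Finset V} {N : Submodule K V → ℕ → Submodule ℝ (Submodule K V → ℝ)}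

theorem AF_eq_zero {F : Submodule K V} {w : ℕ} (h : w < rk F ∨ finrank K V < w)
    {a : Submodule K V → ℝ} (ha : a ∈ AF F w) : a = 0 := by
  funext U
  by_contra h0
  obtain ⟨h1, h2⟩ := ha U h0
  have := rk_mono h1
  have := rk_le U
  omega

theorem Pre.mul' (hP : Pre S N) {F : Submodule K V} {w : ℕ} {s : V} (hs : s ∈ S)
    {a : Submodule K V → ℝ} (ha : a ∈ N F w) : mu s a ∈ N F (w + 1) :=
  hP.up _ _ s hs (hP.mul _ _ s hs a ha)

theorem Pre.Lc_mem (hP : Pre S N) {c : V → ℝ} (hc : ∀ v, c v ≠ 0 → v ∈ S) {F : Submodule K V}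
    {w : ℕ} {a : Submodule K V → ℝ} (ha : a ∈ N F w) : Lc c a ∈ N F (w + 1) := by
  rw [Lc_apply]
  refine Submodule.sum_mem _ fun v _ => ?_
  by_cases h : c v = 0
  · simp [h]
  · exact Submodule.smul_mem _ _ (hP.mul' (hc v h) ha)

theorem Pre.Lpow_mem (hP : Pre S N) {c : V → ℝ} (hc : ∀ v, c v ≠ 0 → v ∈ S) {F : Submodule K V}
    {w : ℕ} {a : Submodule K V → ℝ} (n : ℕ) (ha : a ∈ N F w) : (Lc c ^ n) a ∈ N F (w + n) := by
  induction n with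
  | zero => exact ha
  | succ n ih => rw [Lpow_succ]; exact hP.Lc_mem hc ih

theorem HL (hP : Pre S N) {c : V → ℝ} (hc0 : ∀ v, 0 ≤ c v) (hcS : ∀ v, c v ≠ 0 → v ∈ S)
    {F : Submodule K V} (hHR : ∀ v, v ∉ F → c v ≠ 0 → HR N c (up F v)) {w σ : ℕ}
    (hinj : ∀ a ∈ N F w, (∀ v, c v ≠ 0 → mu v a = 0) → a = 0)
    (hw : 2 * w + (σ + 1) = finrank K V + rk F) {a : Submodule K V → ℝ} (ha : a ∈ N F w)
    (h : ∀ b ∈ N F w, pp F ((Lc c ^ (σ+1)) a) b = 0) : a = 0 := by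
  have haA := hP.sub _ _ ha
  have key : ∀ v, v ∉ F → c v ≠ 0 → mu v a ≠ 0 →
      0 < (-1 : ℝ) ^ (w + rk F) * pp (up F v) ((Lc c ^ σ) (mu v a)) (mu v a) := by
    intro v hv hcv h0
    have := hHR v hv hcv (w+1) σ (by rw [rk_up hv]; omega) (mu v a)
      (hP.mul _ _ v (hcS v hcv) a ha) ?_ h0
    · rw [rk_up hv] at this
      have e : (-1 : ℝ) ^ (w + 1 + (rk F + 1)) = (-1) ^ (w + rk F) := by ring
      rwa [e] at this
    · intro w' hw' u hu
      obtain rfl : w' = w := by omega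
      rw [Lpow_mu, ← pp_adj hv (Lpow_mem _ haA) (hP.sub _ _ hu)]
      exact h u (hP.up _ _ v (hcS v hcv) hu)
  have e1 : pp F ((Lc c ^ (σ+1)) a) a =
      ∑ v, c v * pp F (mu v ((Lc c ^ σ) a)) a := by
    rw [Lpow_succ, Lc_apply, map_sum, LinearMap.sum_apply]
    simp
  have e2 : ∀ v, v ∉ F → pp F (mu v ((Lc c ^ σ) a)) a =
      pp (up F v) ((Lc c ^ σ) (mu v a)) (mu v a) := by
    intro v hv
    rw [pp_mu hv (Lpow_mem _ haA) haA, Lpow_mu]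
  have e3 : ∀ v, v ∈ F → pp F (mu v ((Lc c ^ σ) a)) a = 0 := by
    intro v hv
    rw [mu_eq_zero hv (Lpow_mem _ haA)]; simp
  have e4 : ∑ v, c v * ((-1 : ℝ) ^ (w + rk F) * pp F (mu v ((Lc c ^ σ) a)) a) = 0 := by
    have := h a ha
    rw [e1] at this
    have h2 : (-1 : ℝ) ^ (w + rk F) * ∑ v, c v * pp F (mu v ((Lc c ^ σ) a)) a = 0 := by
      rw [this, mul_zero]
    rw [Finset.mul_sum] at h2
    rw [← h2]
    exact Finset.sum_congr rfl fun v _ => by ring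
  have e5 : ∀ v ∈ Finset.univ, 0 ≤ c v * ((-1 : ℝ) ^ (w + rk F) * pp F (mu v ((Lc c ^ σ) a)) a) := by
    intro v _
    by_cases hv : v ∈ F
    · rw [e3 v hv]; simp
    · rw [e2 v hv]
      by_cases hcv : c v = 0
      · simp [hcv]
      · refine mul_nonneg (hc0 v) ?_
        by_cases h0 : mu v a = 0
        · simp [h0]
        · exact (key v hv hcv h0).le
  have e6 := (Finset.sum_eq_zero_iff_of_nonneg e5).1 e4
  refine hinj a ha fun v hcv => ?_
  by_cases hv : v ∈ F
  · exact mu_eq_zero hv haA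
  · by_contra h0
    have h1 := e6 v (Finset.mem_univ _)
    rw [e2 v hv] at h1
    have := mul_pos (lt_of_le_of_ne (hc0 v) (Ne.symm hcv)) (key v hv hcv h0)
    linarith

open Classical in
/-- path of weights -/
noncomputable def cpath (S : Finset V) (n : V) (t : ℝ) (v : V) : ℝ :=
  if v = n then t else ind S v

open Classical in
theorem Lc_cpath (S : Finset V) (n : V) (t : ℝ) :
    Lc (K := K) (cpath S n t) = Lc (cpath S n 0) + t • mu n := by
  refine LinearMap.ext fun a => ?_
  rw [LinearMap.add_apply, LinearMap.smul_apply, Lc_apply, Lc_apply]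
  rw [← Finset.add_sum_erase _ _ (Finset.mem_univ n), ← Finset.add_sum_erase _ _ (Finset.mem_univ n)]
  have : ∑ x ∈ Finset.univ.erase n, cpath S n t x • mu (K := K) x a =
      ∑ x ∈ Finset.univ.erase n, cpath S n 0 x • mu x a := by
    refine Finset.sum_congr rfl fun v hv => ?_
    have : v ≠ n := Finset.ne_of_mem_erase hv
    simp [cpath, this]
  rw [this]
  simp only [cpath, if_true, zero_smul, zero_add]
  rw [add_comm]

theorem cont_Lpow (S : Finset V) (n : V) (k : ℕ) :
    Continuous fun p : (Set.Icc (0:ℝ) 1) × (Submodule K V → ℝ) =>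
      (Lc (cpath S n (p.1 : ℝ)) ^ k) p.2 := by
  induction k with
  | zero => exact continuous_snd
  | succ k ih =>
    have h1 : Continuous (Lc (K := K) (cpath S n 0)) := LinearMap.continuous_of_finiteDimensional _
    have h2 : Continuous (mu (K := K) n) := LinearMap.continuous_of_finiteDimensional _
    have : (fun p : (Set.Icc (0:ℝ) 1) × (Submodule K V → ℝ) =>
        (Lc (cpath S n (p.1 : ℝ)) ^ (k+1)) p.2) = fun p =>
        Lc (cpath S n 0) ((Lc (cpath S n (p.1 : ℝ)) ^ k) p.2) +
          (p.1 : ℝ) • mu n ((Lc (cpath S n (p.1 : ℝ)) ^ k) p.2) := by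
      funext p
      rw [Lpow_succ, Lc_cpath S n p.1, LinearMap.add_apply, LinearMap.smul_apply]
    rw [this]
    exact (h1.comp ih).add ((continuous_subtype_val.comp continuous_fst).smul (h2.comp ih))

theorem cont_pp (F : Submodule K V) :
    Continuous fun p : (Submodule K V → ℝ) × (Submodule K V → ℝ) => pp F p.1 p.2 := by
  simp only [pp, LinearMap.mk₂_apply]
  refine continuous_finsetSum _ fun U _ => continuous_finsetSum _ fun W _ => ?_
  split_ifs
  · fun_prop
  · exact continuous_const

theorem cont_B (S : Finset V) (n : V) (k : ℕ) (F : Submodule K V) :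
    Continuous fun p : (Set.Icc (0:ℝ) 1) × (Submodule K V → ℝ) × (Submodule K V → ℝ) =>
      ((pp F) ∘ₗ (Lc (cpath S n (p.1 : ℝ)) ^ k)) p.2.1 p.2.2 := by
  have h0 : Continuous fun p : (Set.Icc (0:ℝ) 1) × (Submodule K V → ℝ) × (Submodule K V → ℝ) =>
      (p.1, p.2.1) := by fun_prop
  have h1 := (cont_Lpow (K := K) S n k).comp h0
  have h2 : Continuous fun p : (Set.Icc (0:ℝ) 1) × (Submodule K V → ℝ) × (Submodule K V → ℝ) =>
      p.2.2 := by fun_prop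
  have h3 := (cont_pp F).comp (h1.prodMk h2)
  simpa only [Function.comp_def, LinearMap.comp_apply] using h3

theorem exists_not_mem {S : Finset V} (hS : Submodule.span K (S : Set V) = ⊤) {F : Submodule K V}
    (hF : F ≠ ⊤) : ∃ s ∈ S, s ∉ F := by
  by_contra! h
  exact hF (top_le_iff.1 (hS ▸ Submodule.span_le.2 h))

open Classical in
theorem inj_erase (hS : Sys S N) {n : V} (hn : n ∈ S)
    (hspan : Submodule.span K ((S.erase n : Finset V) : Set V) = ⊤) {F : Submodule K V} {w : ℕ}
    (hw : 2 * w < finrank K V + rk F) {a : Submodule K V → ℝ} (ha : a ∈ N F w)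
    (h : ∀ s ∈ S.erase n, mu s a = 0) : a = 0 := by
  have haA := hS.sub _ _ ha
  by_cases hF : F = ⊤
  · subst hF
    rw [rk_top] at hw
    exact AF_eq_zero (Or.inl (by rw [rk_top]; omega)) haA
  have hna : mu n a = 0 := by
    by_cases hnF : n ∈ F
    · exact mu_eq_zero hnF haA
    by_cases hG : up F n = ⊤
    · obtain ⟨s, hs, hsF⟩ := exists_not_mem hspan hF
      have : up F n = up F s := (up_eq_of_mem hsF (by rw [hG]; trivial)).symm
      rw [mu_congr this haA]
      exact h s hs
    · refine hS.inj (up F n) (w+1) hG (by rw [rk_up hnF]; omega) _ (hS.mul _ _ n hn a ha) ?_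
      intro s hs
      by_cases hsn : s = n
      · subst hsn
        exact mu_eq_zero (mem_up _ _) (mu_mem s haA)
      · rw [mu_comm, h s (Finset.mem_erase.2 ⟨hsn, hs⟩), map_zero]
  refine hS.inj F w hF hw.le a ha fun s hs => ?_
  by_cases hsn : s = n
  · rw [hsn]; exact hna
  · exact h s (Finset.mem_erase.2 ⟨hsn, hs⟩)

set_option maxHeartbeats 1000000 in
open Classical in
theorem hr_path (hS : Sys S N) {n : V} (hn : n ∈ S)
    (hspan : Submodule.span K ((S.erase n : Finset V) : Set V) = ⊤) (k : ℕ) :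
    ∀ F : Submodule K V, finrank K V = rk F + k → ∀ t ∈ Set.Icc (0:ℝ) 1, HR N (cpath S n t) F := by
  induction k using Nat.strong_induction_on with
  | _ k ih =>
  intro F hF
  have hc0 : ∀ t ∈ Set.Icc (0:ℝ) 1, ∀ v, 0 ≤ cpath S n t v := by
    intro t ht v
    unfold cpath ind
    split_ifs
    · exact ht.1
    · norm_num
    · norm_num
  have hcS : ∀ t : ℝ, ∀ v, cpath S n t v ≠ 0 → v ∈ S := by
    intro t v hv
    by_cases h : v = n
    · rw [h]; exact hn
    · by_contra h2
      simp [cpath, ind, h, h2] at hv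
  have hcS' : ∀ t : ℝ, ∀ v ∈ S.erase n, cpath S n t v ≠ 0 := by
    intro t v hv
    rw [Finset.mem_erase] at hv
    simp [cpath, ind, hv]
  have hHL : ∀ t ∈ Set.Icc (0:ℝ) 1, ∀ w σ, 2 * w + (σ + 1) = finrank K V + rk F →
      ∀ a ∈ N F w, (∀ b ∈ N F w, pp F ((Lc (cpath S n t) ^ (σ+1)) a) b = 0) → a = 0 := by
    intro t ht w σ hw a ha h
    refine HL hS.toPre (hc0 t ht) (hcS t) ?_ ?_ hw ha h
    · intro v hv _
      have h1 := rk_up hv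
      have h2 := rk_le (up F v)
      exact ih (k-1) (by omega) (up F v) (by omega) t ht
    · intro a ha h
      exact inj_erase hS hn hspan (by omega) ha fun s hs => h s (hcS' t s hs)
  intro t₁ ht₁ w σ hw
  obtain ⟨W, hW⟩ : ∃ W : Submodule ℝ (Submodule K V → ℝ),
      (∀ u, u ∈ W ↔ u = 0 ∨ ∃ w', w' + 1 = w ∧ u ∈ N F w') := by
    cases w with
    | zero => exact ⟨⊥, fun u => by simp⟩
    | succ w =>
      refine ⟨N F w, fun u => ⟨fun h => Or.inr ⟨w, rfl, h⟩, ?_⟩⟩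
      rintro (rfl | ⟨w', h1, h2⟩)
      · exact zero_mem _
      · obtain rfl : w' = w := by omega
        exact h2
  have hprim : ∀ t : ℝ, ∀ a ∈ N F w,
      ((∀ w', w' + 1 = w → ∀ u ∈ N F w', pp F ((Lc (cpath S n t) ^ (σ+1)) a) u = 0) ↔
      ∀ u ∈ W, pp F ((Lc (cpath S n t) ^ σ) a) (Lc (cpath S n t) u) = 0) := by
    intro t a ha
    constructor
    · intro h u hu
      rcases (hW u).1 hu with rfl | ⟨w', h1, h2⟩
      · simp
      · rw [← pp_Lc_symm _ (Lpow_mem _ (hS.sub _ _ ha)) (hS.sub _ _ h2), ← Lpow_succ]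
        exact h w' h1 u h2
    · intro h w' h1 u h2
      rw [Lpow_succ, pp_Lc_symm _ (Lpow_mem _ (hS.sub _ _ ha)) (hS.sub _ _ h2)]
      exact h u ((hW u).2 (Or.inr ⟨w', h1, h2⟩))
  have main := path_lemma (T := Set.Icc (0:ℝ) 1) (X := Submodule K V → ℝ) (N F w) W
    (fun t => (pp F) ∘ₗ (Lc (cpath S n (t : ℝ)) ^ σ)) (fun t => Lc (cpath S n (t : ℝ)))
    ?_ ?_ ?_ ?_ ?_ ?_ ((-1 : ℝ) ^ (w + rk F)) (by positivity) ⟨1, by simp⟩ ⟨t₁, ht₁⟩ ?_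
  · intro a ha hp h0
    exact main a ha ((hprim t₁ a ha).1 hp) h0
  · exact cont_B S n σ F
  · simpa using cont_Lpow (K := K) S n 1
  · intro t u hu
    rcases (hW u).1 hu with rfl | ⟨w', h1, h2⟩
    · rw [map_zero]; exact zero_mem _
    · rw [← h1]; exact hS.toPre.Lc_mem (hcS t) h2
  · intro t x hx y hy
    simp only [LinearMap.comp_apply]
    rw [pp_Lpow_symm _ _ (hS.sub _ _ hx) (hS.sub _ _ hy), pp_symm]
  · intro t x hx h
    cases σ with
    | zero => exact hS.nd F w w (by omega) x hx (fun b hb => h b hb)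
    | succ σ => exact hHL t t.2 w σ hw x hx (fun b hb => h b hb)
  · intro t u hu h
    rcases (hW u).1 hu with rfl | ⟨w', h1, h2⟩
    · rfl
    · refine hHL t t.2 w' (σ+1) (by omega) u h2 fun b hb => ?_
      have := h b ((hW b).2 (Or.inr ⟨w', h1, hb⟩))
      simp only [LinearMap.comp_apply] at this
      rw [← Lpow_succ', ← pp_Lc_symm _ (Lpow_mem _ (hS.sub _ _ h2)) (hS.sub _ _ hb),
        ← Lpow_succ] at this
      exact this
  · intro x hx hp h0
    have e : cpath S n 1 = ind S := by
      funext v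
      by_cases h : v = n
      · simp [cpath, ind, h, hn]
      · simp [cpath, h]
    have hp' := (hprim 1 x hx).2 hp
    have := hS.hr F w σ hw x hx (by rw [← e]; exact hp') h0
    rw [← e] at this
    exact this

open Classical in
theorem hr_erase (hS : Sys S N) {n : V} (hn : n ∈ S)
    (hspan : Submodule.span K ((S.erase n : Finset V) : Set V) = ⊤) (F : Submodule K V) :
    HR N (ind (S.erase n)) F := by
  have e : cpath S n 0 = ind (S.erase n) := by
    funext v
    by_cases h : v = n
    · simp [cpath, ind, h]
    · simp [cpath, ind, h]
  rw [← e]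
  exact hr_path hS hn hspan (finrank K V - rk F) F (by have := rk_le F; omega) 0 (by simp)

end Systems
end TopHeavy

namespace TopHeavy
open Module

section LinAlg
variable {X : Type} [AddCommGroup X] [Module ℝ X] [FiniteDimensional ℝ X]

theorem represent (P Q : Submodule ℝ X) (β : X →ₗ[ℝ] X →ₗ[ℝ] ℝ)
    (h1 : ∀ a ∈ P, (∀ b ∈ Q, β a b = 0) → a = 0)
    (h2 : ∀ b ∈ Q, (∀ a ∈ P, β a b = 0) → b = 0) (φ : X →ₗ[ℝ] ℝ) :
    ∃ a ∈ P, ∀ b ∈ Q, β a b = φ b := by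
  let T : P →ₗ[ℝ] Dual ℝ Q := (β.compl₁₂ P.subtype Q.subtype)
  let T' : Q →ₗ[ℝ] Dual ℝ P := (β.flip.compl₁₂ Q.subtype P.subtype)
  have hT : Function.Injective T := by
    rw [injective_iff_map_eq_zero]
    intro a ha
    apply Subtype.ext
    exact h1 a a.2 fun b hb => LinearMap.congr_fun ha ⟨b, hb⟩
  have hT' : Function.Injective T' := by
    rw [injective_iff_map_eq_zero]
    intro a ha
    apply Subtype.ext
    exact h2 a a.2 fun b hb => LinearMap.congr_fun ha ⟨b, hb⟩
  have e1 := LinearMap.finrank_le_finrank_of_injective hT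
  have e2 := LinearMap.finrank_le_finrank_of_injective hT'
  rw [Subspace.dual_finrank_eq] at e1 e2
  have hs : Function.Surjective T :=
    (LinearMap.injective_iff_surjective_of_finrank_eq_finrank
      (by rw [Subspace.dual_finrank_eq]; omega)).1 hT
  obtain ⟨a, ha⟩ := hs (φ ∘ₗ Q.subtype)
  exact ⟨a, a.2, fun b hb => LinearMap.congr_fun ha ⟨b, hb⟩⟩

theorem exists_proj (P Q : Submodule ℝ X) (h : ∀ a ∈ P, a ∈ Q → a = 0) :
    ∃ f : X →ₗ[ℝ] X, (∀ a ∈ P, f a = a) ∧ ∀ a ∈ Q, f a = 0 := by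
  let T : P × Q →ₗ[ℝ] X := P.subtype.coprod Q.subtype
  have hT : LinearMap.ker T = ⊥ := by
    rw [LinearMap.ker_eq_bot']
    rintro ⟨a, b⟩ hab
    have hab' : (a : X) + b = 0 := by simpa [T] using hab
    have ha : (a : X) = 0 := h a a.2 (by rw [eq_neg_of_add_eq_zero_left hab']; exact Q.neg_mem b.2)
    have hb : (b : X) = 0 := by rw [ha, zero_add] at hab'; exact hab'
    ext <;> simp [ha, hb]
  obtain ⟨g, hg⟩ := LinearMap.exists_leftInverse_of_injective T hT
  refine ⟨P.subtype ∘ₗ (LinearMap.fst ℝ P Q) ∘ₗ g, fun a ha => ?_, fun a ha => ?_⟩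
  · have : g a = (⟨a, ha⟩, 0) := by
      have := LinearMap.congr_fun hg (⟨a, ha⟩, 0)
      simpa [T] using this
    simp [this]
  · have : g a = (0, ⟨a, ha⟩) := by
      have := LinearMap.congr_fun hg (0, ⟨a, ha⟩)
      simpa [T] using this
    simp [this]
end LinAlg

section Split
variable {K V : Type} [Field K] [AddCommGroup V] [Module K V] [Finite V] [Fintype V]

/-- lower half of the splitting -/
def lowS (S : Finset V) (N P : Submodule K V → ℕ → Submodule ℝ (Submodule K V → ℝ))
    (F : Submodule K V) (w : ℕ) : Submodule ℝ (Submodule K V → ℝ) where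
  carrier := {a | a ∈ N F w ∧ ∀ s ∈ S, s ∉ F → mu s a ∈ P (up F s) (w + 1)}
  add_mem' {a b} ha hb := ⟨add_mem ha.1 hb.1, fun s hs hF => by
    rw [map_add]; exact add_mem (ha.2 s hs hF) (hb.2 s hs hF)⟩
  zero_mem' := ⟨zero_mem _, fun s _ _ => by rw [map_zero]; exact zero_mem _⟩
  smul_mem' c a ha := ⟨Submodule.smul_mem _ _ ha.1, fun s hs hF => by
    rw [map_smul]; exact Submodule.smul_mem _ _ (ha.2 s hs hF)⟩

/-- middle degree -/
def midS (S : Finset V) (P : Submodule K V → ℕ → Submodule ℝ (Submodule K V → ℝ))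
    (F : Submodule K V) (w : ℕ) : Submodule ℝ (Submodule K V → ℝ) :=
  ⨆ s ∈ S, ⨆ (_ : s ∉ F), P (up F s) w

/-- orthogonal complement inside `M` -/
def orthS (M : Submodule ℝ (Submodule K V → ℝ)) (F : Submodule K V)
    (Q : Submodule ℝ (Submodule K V → ℝ)) : Submodule ℝ (Submodule K V → ℝ) where
  carrier := {a | a ∈ M ∧ ∀ b ∈ Q, pp F a b = 0}
  add_mem' {a b} ha hb := ⟨add_mem ha.1 hb.1, fun c hc => by
    rw [map_add, LinearMap.add_apply, ha.2 c hc, hb.2 c hc, add_zero]⟩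
  zero_mem' := ⟨zero_mem _, fun s _ => by simp⟩
  smul_mem' c a ha := ⟨Submodule.smul_mem _ _ ha.1, fun b hb => by
    rw [map_smul, LinearMap.smul_apply, ha.2 b hb, smul_zero]⟩

/-- The recursive splitting, with fuel. -/
noncomputable def spl (S : Finset V) (N : Submodule K V → ℕ → Submodule ℝ (Submodule K V → ℝ)) :
    ℕ → (Submodule K V → ℕ → Submodule ℝ (Submodule K V → ℝ)) ×
      (Submodule K V → ℕ → Submodule ℝ (Submodule K V → ℝ))
  | 0 => (N, fun _ _ => ⊥)
  | k + 1 =>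
    (fun F w => if 2 * w < finrank K V + rk F then lowS S N (spl S N k).1 F w
      else if 2 * w = finrank K V + rk F then midS S (spl S N k).1 F w
      else orthS (N F w) F (lowS S N (spl S N k).2 F (finrank K V + rk F - w)),
     fun F w => if 2 * w < finrank K V + rk F then lowS S N (spl S N k).2 F w
      else if 2 * w = finrank K V + rk F then orthS (N F w) F (midS S (spl S N k).1 F w)
      else orthS (N F w) F (lowS S N (spl S N k).1 F (finrank K V + rk F - w)))

/-- the new system -/
noncomputable def NN (S : Finset V) (N : Submodule K V → ℕ → Submodule ℝ (Submodule K V → ℝ))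
    (F : Submodule K V) (w : ℕ) : Submodule ℝ (Submodule K V → ℝ) :=
  (spl S N (finrank K V - rk F)).1 F w

/-- the complement -/
noncomputable def RR (S : Finset V) (N : Submodule K V → ℕ → Submodule ℝ (Submodule K V → ℝ))
    (F : Submodule K V) (w : ℕ) : Submodule ℝ (Submodule K V → ℝ) :=
  (spl S N (finrank K V - rk F)).2 F w

variable {S : Finset V} {N : Submodule K V → ℕ → Submodule ℝ (Submodule K V → ℝ)}

theorem NN_top (w : ℕ) : NN S N ⊤ w = N ⊤ w := by
  unfold NN; rw [rk_top, Nat.sub_self]; rfl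
theorem RR_top (w : ℕ) : RR S N ⊤ w = ⊥ := by
  unfold RR; rw [rk_top, Nat.sub_self]; rfl

theorem rk_lt {F : Submodule K V} (hF : F ≠ ⊤) : rk F < finrank K V := by
  by_contra h
  exact hF (eq_top_of_rk (by omega))

theorem fuel {F : Submodule K V} (hF : F ≠ ⊤) :
    ∃ k, finrank K V - rk F = k + 1 ∧ ∀ s, s ∉ F → finrank K V - rk (up F s) = k := by
  have := rk_lt hF
  exact ⟨finrank K V - rk F - 1, by omega, fun s hs => by rw [rk_up hs]; omega⟩

theorem mem_low {P : Submodule K V → ℕ → Submodule ℝ (Submodule K V → ℝ)} {F : Submodule K V}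
    {w : ℕ} {a : Submodule K V → ℝ} :
    a ∈ lowS S N P F w ↔ a ∈ N F w ∧ ∀ s ∈ S, s ∉ F → mu s a ∈ P (up F s) (w + 1) := Iff.rfl

theorem mem_NN_low {F : Submodule K V} (hF : F ≠ ⊤) {w : ℕ} (hw : 2 * w < finrank K V + rk F)
    {a : Submodule K V → ℝ} :
    a ∈ NN S N F w ↔ a ∈ N F w ∧ ∀ s ∈ S, s ∉ F → mu s a ∈ NN S N (up F s) (w + 1) := by
  obtain ⟨k, hk, hk'⟩ := fuel hF
  unfold NN
  rw [hk]
  simp only [spl, if_pos hw]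
  rw [mem_low]
  refine and_congr_right fun _ => forall_congr' fun s => forall_congr' fun _ =>
    forall_congr' fun hs => ?_
  rw [hk' s hs]

theorem mem_RR_low {F : Submodule K V} (hF : F ≠ ⊤) {w : ℕ} (hw : 2 * w < finrank K V + rk F)
    {a : Submodule K V → ℝ} :
    a ∈ RR S N F w ↔ a ∈ N F w ∧ ∀ s ∈ S, s ∉ F → mu s a ∈ RR S N (up F s) (w + 1) := by
  obtain ⟨k, hk, hk'⟩ := fuel hF
  unfold RR
  rw [hk]
  simp only [spl, if_pos hw]
  rw [mem_low]
  refine and_congr_right fun _ => forall_congr' fun s => forall_congr' fun _ =>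
    forall_congr' fun hs => ?_
  rw [hk' s hs]

theorem NN_mid {F : Submodule K V} (hF : F ≠ ⊤) {w : ℕ} (hw : 2 * w = finrank K V + rk F) :
    NN S N F w = ⨆ s ∈ S, ⨆ (_ : s ∉ F), NN S N (up F s) w := by
  obtain ⟨k, hk, hk'⟩ := fuel hF
  unfold NN
  rw [hk]
  simp only [spl, if_neg (show ¬ 2 * w < finrank K V + rk F by omega), if_pos hw]
  refine iSup_congr fun s => iSup_congr fun _ => iSup_congr fun hs => ?_
  rw [hk' s hs]

theorem mem_RR_mid {F : Submodule K V} (hF : F ≠ ⊤) {w : ℕ} (hw : 2 * w = finrank K V + rk F)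
    {a : Submodule K V → ℝ} :
    a ∈ RR S N F w ↔ a ∈ N F w ∧ ∀ b ∈ NN S N F w, pp F a b = 0 := by
  obtain ⟨k, hk, hk'⟩ := fuel hF
  unfold RR NN
  rw [hk]
  simp only [spl, if_neg (show ¬ 2 * w < finrank K V + rk F by omega), if_pos hw]
  rfl

theorem mem_NN_high {F : Submodule K V} (hF : F ≠ ⊤) {w w' : ℕ} (hw : w + w' = finrank K V + rk F)
    (hlt : w' < w) {a : Submodule K V → ℝ} :
    a ∈ NN S N F w ↔ a ∈ N F w ∧ ∀ b ∈ RR S N F w', pp F a b = 0 := by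
  obtain ⟨k, hk, hk'⟩ := fuel hF
  unfold RR NN
  rw [hk]
  simp only [spl, if_neg (show ¬ 2 * w < finrank K V + rk F by omega),
    if_neg (show ¬ 2 * w = finrank K V + rk F by omega),
    if_pos (show 2 * w' < finrank K V + rk F by omega)]
  rw [show finrank K V + rk F - w = w' by omega]
  rfl

theorem mem_RR_high {F : Submodule K V} (hF : F ≠ ⊤) {w w' : ℕ} (hw : w + w' = finrank K V + rk F)
    (hlt : w' < w) {a : Submodule K V → ℝ} :
    a ∈ RR S N F w ↔ a ∈ N F w ∧ ∀ b ∈ NN S N F w', pp F a b = 0 := by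
  obtain ⟨k, hk, hk'⟩ := fuel hF
  unfold RR NN
  rw [hk]
  simp only [spl, if_neg (show ¬ 2 * w < finrank K V + rk F by omega),
    if_neg (show ¬ 2 * w = finrank K V + rk F by omega),
    if_pos (show 2 * w' < finrank K V + rk F by omega)]
  rw [show finrank K V + rk F - w = w' by omega]
  rfl

theorem NN_le_far {F : Submodule K V} (hF : F ≠ ⊤) {w : ℕ} (hw : finrank K V + rk F < 2 * w) :
    NN S N F w ≤ N F w ∧ RR S N F w ≤ N F w := by
  obtain ⟨k, hk, hk'⟩ := fuel hF
  unfold RR NN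
  rw [hk]
  simp only [spl, if_neg (show ¬ 2 * w < finrank K V + rk F by omega),
    if_neg (show ¬ 2 * w = finrank K V + rk F by omega)]
  exact ⟨fun a ha => ha.1, fun a ha => ha.1⟩

theorem NN_mid_induction {F : Submodule K V} (hF : F ≠ ⊤) {w : ℕ}
    (hw : 2 * w = finrank K V + rk F) {Q : Submodule ℝ (Submodule K V → ℝ)}
    (h : ∀ s ∈ S, s ∉ F → ∀ b ∈ NN S N (up F s) w, b ∈ Q) : NN S N F w ≤ Q := by
  rw [NN_mid hF hw]
  exact iSup_le fun s => iSup_le fun hs => iSup_le fun hsF => h s hs hsF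

open Classical in
theorem lim_erase (hS : Sys S N) {n : V} (hn : n ∈ S)
    (hspan : Submodule.span K ((S.erase n : Finset V) : Set V) = ⊤) {F : Submodule K V} (w : ℕ)
    (hF : F ≠ ⊤) (g : V → (Submodule K V → ℝ))
    (h1 : ∀ s ∈ S.erase n, s ∉ F → g s ∈ N (up F s) (w + 1))
    (h2 : ∀ s ∈ S.erase n, s ∉ F → ∀ t ∈ S.erase n, t ∉ F → up F s = up F t → g s = g t)
    (h3 : ∀ s ∈ S.erase n, s ∉ F → ∀ t ∈ S.erase n, t ∉ F → mu t (g s) = mu s (g t)) :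
    ∃ a ∈ N F w, ∀ s ∈ S.erase n, s ∉ F → mu s a = g s := by
  have hsub : ∀ s ∈ S.erase n, s ∈ S := fun s hs => Finset.mem_of_mem_erase hs
  have her : ∀ s ∈ S, s ≠ n → s ∈ S.erase n := fun s hs h => Finset.mem_erase.2 ⟨h, hs⟩
  have hne : ∀ s ∈ S.erase n, s ≠ n := fun s hs => Finset.ne_of_mem_erase hs
  by_cases hnF : n ∈ F
  · have hx : ∀ s ∈ S, s ∉ F → s ∈ S.erase n := fun s hs hsF =>
      her s hs (fun h => hsF (h ▸ hnF))
    obtain ⟨a, ha, h⟩ := hS.lim F w hF g (fun s hs hF => h1 s (hx s hs hF) hF)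
      (fun s hs hF t ht hF' => h2 s (hx s hs hF) hF t (hx t ht hF') hF')
      (fun s hs hF t ht hF' => h3 s (hx s hs hF) hF t (hx t ht hF') hF')
    exact ⟨a, ha, fun s hs hF => h s (hsub s hs) hF⟩
  -- it suffices to find a value at `n`
  suffices H : ∃ b ∈ N (up F n) (w+1), (∀ s ∈ S.erase n, s ∉ F → up F s = up F n → g s = b) ∧
      ∀ s ∈ S.erase n, s ∉ F → mu s b = mu n (g s) by
    obtain ⟨b, hb1, hb2, hb3⟩ := H
    have gn : Function.update g n b n = b := Function.update_self _ _ _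
    have gs : ∀ s, s ≠ n → Function.update g n b s = g s := fun s h => Function.update_of_ne h _ _
    have hl := hS.lim F w hF (Function.update g n b)
    refine Exists.elim (hl ?_ ?_ ?_) ?_
    rotate_left 3
    · rintro a ⟨ha, h⟩
      refine ⟨a, ha, fun s hs hsF => ?_⟩
      rw [h s (hsub s hs) hsF, gs s (hne s hs)]
    · intro s hs hsF
      by_cases h : s = n
      · subst h; rw [gn]; exact hb1
      · rw [gs s h]; exact h1 s (her s hs h) hsF
    · intro s hs hsF t ht htF e
      by_cases h : s = n
      · subst h
        by_cases h' : t = s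
        · rw [h']
        · rw [gn, gs t h']; exact (hb2 t (her t ht h') htF e.symm).symm
      · by_cases h' : t = n
        · subst h'; rw [gn, gs s h]; exact hb2 s (her s hs h) hsF e
        · rw [gs s h, gs t h']; exact h2 s (her s hs h) hsF t (her t ht h') htF e
    · intro s hs hsF t ht htF
      by_cases h : s = n
      · subst h
        by_cases h' : t = s
        · rw [h']
        · rw [gn, gs t h']; exact hb3 t (her t ht h') htF
      · by_cases h' : t = n
        · subst h'; rw [gn, gs s h]; exact (hb3 s (her s hs h) hsF).symm
        · rw [gs s h, gs t h']; exact h3 s (her s hs h) hsF t (her t ht h') htF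
  by_cases hex : ∃ s ∈ S.erase n, s ∉ F ∧ up F s = up F n
  · obtain ⟨s₀, hs₀, hs₀F, e⟩ := hex
    refine ⟨g s₀, e ▸ h1 s₀ hs₀ hs₀F, fun s hs hsF e' => h2 s hs hsF s₀ hs₀ hs₀F (e'.trans e.symm),
      fun s hs hsF => ?_⟩
    rw [h3 s₀ hs₀ hs₀F s hs hsF]
    exact mu_congr (F := up F s) (mem_iff_of_up_eq e (le_up _ _)).2 (hS.sub _ _ (h1 s hs hsF))
  · push Not at hex
    have hG : up F n ≠ ⊤ := by
      intro hG
      obtain ⟨s, hs, hsF⟩ := exists_not_mem hspan hF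
      exact hex s hs hsF (up_eq_of_mem hsF (by rw [hG]; trivial))
    have hx : ∀ s ∈ S, s ∉ up F n → s ∈ S.erase n ∧ s ∉ F := fun s hs hsG =>
      ⟨her s hs (fun h => hsG (h ▸ mem_up _ _)), fun h => hsG (le_up _ _ h)⟩
    have hl := hS.lim (up F n) (w+1) hG (fun s => mu n (g s))
    refine Exists.elim (hl ?_ ?_ ?_) ?_
    rotate_left 3
    · rintro b ⟨hb, hb2⟩
      refine ⟨b, hb, fun s hs hsF e => absurd e (hex s hs hsF), fun s hs hsF => ?_⟩
      exact hb2 s (hsub s hs) fun h => hex s hs hsF (up_eq_of_mem hsF h)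
    · intro s hs hsG
      obtain ⟨hs', hsF⟩ := hx s hs hsG
      rw [up_comm]
      exact hS.mul _ _ n hn _ (h1 s hs' hsF)
    · intro s hs hsG t ht htG e
      obtain ⟨hs', hsF⟩ := hx s hs hsG
      obtain ⟨ht', htF⟩ := hx t ht htG
      by_cases hts : t ∈ up F s
      · rw [h2 s hs' hsF t ht' htF (up_eq_of_mem htF hts).symm]
      · have hst : s ∉ up F t := (not_mem_up_iff hsF hts).2
        have e1 : up (up F s) t = up (up F s) n := by
          apply up_eq_of_mem hts
          rw [up_comm, e]; exact mem_up _ _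
        have e2 : up (up F t) s = up (up F t) n := by
          apply up_eq_of_mem hst
          rw [up_comm, ← e]; exact mem_up _ _
        rw [← mu_congr e1 (hS.sub _ _ (h1 s hs' hsF)), ← mu_congr e2 (hS.sub _ _ (h1 t ht' htF))]
        exact h3 s hs' hsF t ht' htF
    · intro s hs hsG t ht htG
      obtain ⟨hs', hsF⟩ := hx s hs hsG
      obtain ⟨ht', htF⟩ := hx t ht htG
      rw [mu_comm t, h3 s hs' hsF t ht' htF, mu_comm n]

/-- Everything we want to know about the splitting at `F`. -/
structure Good (S : Finset V) (N : Submodule K V → ℕ → Submodule ℝ (Submodule K V → ℝ))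
    (F : Submodule K V) : Prop where
  subN : ∀ w, NN S N F w ≤ N F w
  subR : ∀ w, RR S N F w ≤ N F w
  orth : ∀ w w', w + w' = finrank K V + rk F → ∀ a ∈ NN S N F w, ∀ b ∈ RR S N F w', pp F a b = 0
  sup : ∀ w, ∀ a ∈ N F w, ∃ b ∈ NN S N F w, ∃ c ∈ RR S N F w, a = b + c
  disj : ∀ w, ∀ a ∈ NN S N F w, a ∈ RR S N F w → a = 0
  bN : ∀ w, ∀ s ∈ S, s ∉ F → NN S N (up F s) w ≤ NN S N F w
  bR : ∀ w, ∀ s ∈ S, s ∉ F → RR S N (up F s) w ≤ RR S N F w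
  cN : ∀ w, ∀ s ∈ S, s ∉ F → ∀ a ∈ NN S N F w, mu s a ∈ NN S N (up F s) (w + 1)
  cR : ∀ w, ∀ s ∈ S, s ∉ F → ∀ a ∈ RR S N F w, mu s a ∈ RR S N (up F s) (w + 1)

end Split
end TopHeavy

namespace TopHeavy
open Module

section Split2
variable {K V : Type} [Field K] [AddCommGroup V] [Module K V] [Finite V] [Fintype V]
variable {S S' : Finset V} {N : Submodule K V → ℕ → Submodule ℝ (Submodule K V → ℝ)}

theorem Good.charR (hS : Sys S N) {G : Submodule K V} (hG : Good S' N G) {w w' : ℕ}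
    (hw : w + w' = finrank K V + rk G) {a : Submodule K V → ℝ} (ha : a ∈ N G w)
    (h : ∀ b ∈ NN S' N G w', pp G a b = 0) : a ∈ RR S' N G w := by
  obtain ⟨b, hb, c, hc, rfl⟩ := hG.sup w a ha
  have hb0 : b = 0 := by
    refine hS.nd G w w' hw b (hG.subN _ hb) fun x hx => ?_
    obtain ⟨x1, hx1, x2, hx2, rfl⟩ := hG.sup w' x hx
    rw [map_add, hG.orth w w' hw b hb x2 hx2, add_zero]
    have h1 := h x1 hx1
    rw [map_add, LinearMap.add_apply, pp_symm G c, hG.orth w' w (by omega) x1 hx1 c hc,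
      add_zero] at h1
    exact h1
  rw [hb0, zero_add]; exact hc

theorem Good.charN (hS : Sys S N) {G : Submodule K V} (hG : Good S' N G) {w w' : ℕ}
    (hw : w + w' = finrank K V + rk G) {a : Submodule K V → ℝ} (ha : a ∈ N G w)
    (h : ∀ b ∈ RR S' N G w', pp G a b = 0) : a ∈ NN S' N G w := by
  obtain ⟨b, hb, c, hc, rfl⟩ := hG.sup w a ha
  have hb0 : c = 0 := by
    refine hS.nd G w w' hw c (hG.subR _ hc) fun x hx => ?_
    obtain ⟨x1, hx1, x2, hx2, rfl⟩ := hG.sup w' x hx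
    rw [map_add, pp_symm G c x1, hG.orth w' w (by omega) x1 hx1 c hc, zero_add]
    have h1 := h x2 hx2
    rw [map_add, LinearMap.add_apply, hG.orth w w' hw b hb x2 hx2,
      zero_add] at h1
    exact h1
  rw [hb0, add_zero]; exact hb

theorem good_top : Good S' N (⊤ : Submodule K V) where
  subN w := by rw [NN_top]
  subR w := by rw [RR_top]; exact bot_le
  orth w w' _ a _ b hb := by
    rw [RR_top, Submodule.mem_bot] at hb; rw [hb, map_zero]
  sup w a ha := ⟨a, by rw [NN_top]; exact ha, 0, zero_mem _, by simp⟩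
  disj w a _ ha := by rw [RR_top, Submodule.mem_bot] at ha; exact ha
  bN w s _ hs := absurd trivial hs
  bR w s _ hs := absurd trivial hs
  cN w s _ hs := absurd trivial hs
  cR w s _ hs := absurd trivial hs

set_option maxHeartbeats 1000000 in
open Classical in
theorem good_step (hS : Sys S N) {n : V} (hn : n ∈ S)
    (hspan : Submodule.span K ((S.erase n : Finset V) : Set V) = ⊤) {F : Submodule K V}
    (hF : F ≠ ⊤) (ih : ∀ G : Submodule K V, rk F < rk G → Good (S.erase n) N G) :
    Good (S.erase n) N F := by
  set S' := S.erase n with hS'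
  have hsub : ∀ s ∈ S', s ∈ S := fun s hs => Finset.mem_of_mem_erase hs
  have ihG : ∀ s, s ∉ F → Good S' N (up F s) := fun s hs => ih _ (by rw [rk_up hs]; omega)
  have ihG2 : ∀ s, s ∉ F → ∀ t, t ∉ up F s → Good S' N (up (up F s) t) := fun s hs t ht =>
    ih _ (by rw [rk_up ht, rk_up hs]; omega)
  -- multiplication from one contraction to another
  have xN : ∀ w, ∀ s ∈ S', s ∉ F → ∀ t ∈ S', t ∉ F → ∀ a ∈ NN S' N (up F s) w,
      mu t a ∈ NN S' N (up F t) (w+1) := by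
    intro w s hs hsF t ht htF a ha
    by_cases htG : t ∈ up F s
    · rw [mu_eq_zero htG (hS.sub _ _ ((ihG s hsF).subN _ ha))]; exact zero_mem _
    · have h1 := (ihG s hsF).cN w t ht htG a ha
      rw [up_comm] at h1
      exact (ihG t htF).bN _ s hs (not_mem_up_iff hsF htG).2 h1
  have xR : ∀ w, ∀ s ∈ S', s ∉ F → ∀ t ∈ S', t ∉ F → ∀ a ∈ RR S' N (up F s) w,
      mu t a ∈ RR S' N (up F t) (w+1) := by
    intro w s hs hsF t ht htF a ha
    by_cases htG : t ∈ up F s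
    · rw [mu_eq_zero htG (hS.sub _ _ ((ihG s hsF).subR _ ha))]; exact zero_mem _
    · have h1 := (ihG s hsF).cR w t ht htG a ha
      rw [up_comm] at h1
      exact (ihG t htF).bR _ s hs (not_mem_up_iff hsF htG).2 h1
  have subN : ∀ w, NN S' N F w ≤ N F w := by
    intro w
    rcases lt_trichotomy (2 * w) (finrank K V + rk F) with hw | hw | hw
    · exact fun a ha => ((mem_NN_low hF hw).1 ha).1
    · exact NN_mid_induction hF hw fun s hs hsF b hb =>
        hS.up _ _ s (hsub s hs) ((ihG s hsF).subN _ hb)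
    · exact (NN_le_far hF hw).1
  have subR : ∀ w, RR S' N F w ≤ N F w := by
    intro w
    rcases lt_trichotomy (2 * w) (finrank K V + rk F) with hw | hw | hw
    · exact fun a ha => ((mem_RR_low hF hw).1 ha).1
    · exact fun a ha => ((mem_RR_mid hF hw).1 ha).1
    · exact (NN_le_far hF hw).2
  have farz : ∀ w, finrank K V + rk F < w → ∀ G, ∀ a ∈ N G w, a = 0 := fun w hw G a ha =>
    AF_eq_zero (Or.inr (by omega)) (hS.sub _ _ ha)
  -- low degrees
  have bNl : ∀ w, 2 * w < finrank K V + rk F → ∀ s ∈ S', s ∉ F → NN S' N (up F s) w ≤ NN S' N F w := by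
    intro w hw s hs hsF a ha
    exact (mem_NN_low hF hw).2 ⟨hS.up _ _ s (hsub s hs) ((ihG s hsF).subN _ ha),
      fun t ht htF => xN w s hs hsF t ht htF a ha⟩
  have bRl : ∀ w, 2 * w < finrank K V + rk F → ∀ s ∈ S', s ∉ F → RR S' N (up F s) w ≤ RR S' N F w := by
    intro w hw s hs hsF a ha
    exact (mem_RR_low hF hw).2 ⟨hS.up _ _ s (hsub s hs) ((ihG s hsF).subR _ ha),
      fun t ht htF => xR w s hs hsF t ht htF a ha⟩
  have cNl : ∀ w, 2 * w < finrank K V + rk F → ∀ s ∈ S', s ∉ F → ∀ a ∈ NN S' N F w,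
      mu s a ∈ NN S' N (up F s) (w + 1) := fun w hw s hs hsF a ha => ((mem_NN_low hF hw).1 ha).2 s hs hsF
  have cRl : ∀ w, 2 * w < finrank K V + rk F → ∀ s ∈ S', s ∉ F → ∀ a ∈ RR S' N F w,
      mu s a ∈ RR S' N (up F s) (w + 1) := fun w hw s hs hsF a ha => ((mem_RR_low hF hw).1 ha).2 s hs hsF
  have bN : ∀ w, ∀ s ∈ S', s ∉ F → NN S' N (up F s) w ≤ NN S' N F w := by
    intro w s hs hsF
    rcases lt_trichotomy (2 * w) (finrank K V + rk F) with hw | hw | hw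
    · exact bNl w hw s hs hsF
    · rw [NN_mid hF hw]
      exact le_iSup_of_le s (le_iSup_of_le hs (le_iSup_of_le hsF le_rfl))
    · intro a ha
      have haN := hS.up _ _ s (hsub s hs) ((ihG s hsF).subN _ ha)
      by_cases hfar : finrank K V + rk F < w
      · rw [farz w hfar F a haN]; exact zero_mem _
      obtain ⟨w', hw'⟩ : ∃ w', w + w' = finrank K V + rk F := ⟨finrank K V + rk F - w, by omega⟩
      refine (mem_NN_high hF hw' (by omega)).2 ⟨haN, fun b hb => ?_⟩
      rw [pp_symm, pp_adj hsF (hS.sub _ _ (subR _ hb)) (hS.sub _ _ ((ihG s hsF).subN _ ha)), pp_symm]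
      exact (ihG s hsF).orth w (w'+1) (by rw [rk_up hsF]; omega) a ha _
        (cRl w' (by omega) s hs hsF b hb)
  have bR : ∀ w, ∀ s ∈ S', s ∉ F → RR S' N (up F s) w ≤ RR S' N F w := by
    intro w s hs hsF
    rcases lt_trichotomy (2 * w) (finrank K V + rk F) with hw | hw | hw
    · exact bRl w hw s hs hsF
    · intro a ha
      have haN := hS.up _ _ s (hsub s hs) ((ihG s hsF).subR _ ha)
      refine (mem_RR_mid hF hw).2 ⟨haN, fun b hb => ?_⟩
      have : NN S' N F w ≤ LinearMap.ker (pp F a) := by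
        refine NN_mid_induction hF hw fun t ht htF b hb => ?_
        rw [LinearMap.mem_ker, pp_adj htF (hS.sub _ _ haN) (hS.sub _ _ ((ihG t htF).subN _ hb)),
          pp_symm]
        exact (ihG t htF).orth w (w+1) (by rw [rk_up htF]; omega) b hb _
          (xR w s hs hsF t ht htF a ha)
      exact this hb
    · intro a ha
      have haN := hS.up _ _ s (hsub s hs) ((ihG s hsF).subR _ ha)
      by_cases hfar : finrank K V + rk F < w
      · rw [farz w hfar F a haN]; exact zero_mem _
      obtain ⟨w', hw'⟩ : ∃ w', w + w' = finrank K V + rk F := ⟨finrank K V + rk F - w, by omega⟩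
      refine (mem_RR_high hF hw' (by omega)).2 ⟨haN, fun b hb => ?_⟩
      rw [pp_symm, pp_adj hsF (hS.sub _ _ (subN _ hb)) (hS.sub _ _ ((ihG s hsF).subR _ ha))]
      exact (ihG s hsF).orth (w'+1) w (by rw [rk_up hsF]; omega) _
        (cNl w' (by omega) s hs hsF b hb) a ha
  have orth : ∀ w w', w + w' = finrank K V + rk F → ∀ a ∈ NN S' N F w, ∀ b ∈ RR S' N F w',
      pp F a b = 0 := by
    intro w w' hw a ha b hb
    rcases lt_trichotomy w w' with h | h | h
    · rw [pp_symm]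
      exact ((mem_RR_high hF (by omega) h).1 hb).2 a ha
    · subst h
      rw [pp_symm]
      exact ((mem_RR_mid hF (by omega)).1 hb).2 a ha
    · exact ((mem_NN_high hF hw h).1 ha).2 b hb
  have cN : ∀ w, ∀ s ∈ S', s ∉ F → ∀ a ∈ NN S' N F w, mu s a ∈ NN S' N (up F s) (w + 1) := by
    intro w s hs hsF
    rcases lt_trichotomy (2 * w) (finrank K V + rk F) with hw | hw | hw
    · exact cNl w hw s hs hsF
    · intro a ha
      have : NN S' N F w ≤ (NN S' N (up F s) (w + 1)).comap (mu s) :=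
        NN_mid_induction hF hw fun t ht htF b hb => xN w t ht htF s hs hsF b hb
      exact this ha
    · intro a ha
      by_cases hfar : finrank K V + rk F < w
      · rw [farz w hfar F a (subN _ ha), map_zero]; exact zero_mem _
      obtain ⟨w', hw'⟩ : ∃ w', w + w' = finrank K V + rk F := ⟨finrank K V + rk F - w, by omega⟩
      refine (ihG s hsF).charN hS (w' := w') (by rw [rk_up hsF]; omega)
        (hS.mul _ _ s (hsub s hs) a (subN _ ha)) fun b hb => ?_
      rw [← pp_adj hsF (hS.sub _ _ (subN _ ha)) (hS.sub _ _ ((ihG s hsF).subR _ hb))]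
      exact orth w w' hw' a ha b (bR w' s hs hsF hb)
  have cR : ∀ w, ∀ s ∈ S', s ∉ F → ∀ a ∈ RR S' N F w, mu s a ∈ RR S' N (up F s) (w + 1) := by
    intro w s hs hsF
    by_cases hw : 2 * w < finrank K V + rk F
    · exact cRl w hw s hs hsF
    · intro a ha
      by_cases hfar : finrank K V + rk F < w
      · rw [farz w hfar F a (subR _ ha), map_zero]; exact zero_mem _
      obtain ⟨w', hw'⟩ : ∃ w', w + w' = finrank K V + rk F := ⟨finrank K V + rk F - w, by omega⟩
      refine (ihG s hsF).charR hS (w' := w') (by rw [rk_up hsF]; omega)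
        (hS.mul _ _ s (hsub s hs) a (subR _ ha)) fun b hb => ?_
      rw [← pp_adj hsF (hS.sub _ _ (subR _ ha)) (hS.sub _ _ ((ihG s hsF).subN _ hb)), pp_symm]
      exact orth w' w (by omega) b (bN w' s hs hsF hb) a ha
  -- splitting in low degrees
  have disjl : ∀ w, 2 * w < finrank K V + rk F → ∀ a ∈ NN S' N F w, a ∈ RR S' N F w → a = 0 := by
    intro w hw a ha ha'
    refine inj_erase hS hn hspan hw (subN _ ha) fun s hs => ?_
    by_cases hsF : s ∈ F
    · exact mu_eq_zero hsF (hS.sub _ _ (subN _ ha))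
    · exact (ihG s hsF).disj _ _ (cN w s hs hsF a ha) (cR w s hs hsF a ha')
  have supl : ∀ w, 2 * w < finrank K V + rk F → ∀ a ∈ N F w, ∃ b ∈ NN S' N F w,
      ∃ c ∈ RR S' N F w, a = b + c := by
    intro w hw a ha
    have hex : ∀ s, ∃ p : Submodule K V → ℝ, s ∈ S' → s ∉ F → p ∈ NN S' N (up F s) (w+1) ∧
        mu s a - p ∈ RR S' N (up F s) (w+1) := by
      intro s
      by_cases hs : s ∈ S' ∧ s ∉ F
      · obtain ⟨b, hb, c, hc, e⟩ := (ihG s hs.2).sup (w+1) (mu s a) (hS.mul _ _ s (hsub s hs.1) a ha)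
        refine ⟨b, fun _ _ => ⟨hb, ?_⟩⟩
        rw [e, add_sub_cancel_left]; exact hc
      · exact ⟨0, fun h1 h2 => absurd ⟨h1, h2⟩ hs⟩
    choose p hp using hex
    have hl := lim_erase hS hn hspan w hF p
      (fun s hs hsF => (ihG s hsF).subN _ (hp s hs hsF).1)
    refine Exists.elim (hl ?_ ?_) ?_
    · intro s hs hsF t ht htF e
      have e1 := mu_congr e (hS.sub _ _ ha)
      have h1 := hp s hs hsF
      have h2 := hp t ht htF
      rw [← e, ← e1] at h2
      have h3 := (ihG s hsF).disj _ (p s - p t) (sub_mem h1.1 h2.1) (by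
        have := sub_mem h2.2 h1.2
        have e3 : mu s a - p t - (mu s a - p s) = p s - p t := by abel
        rwa [e3] at this)
      exact sub_eq_zero.1 h3
    · intro s hs hsF t ht htF
      have h1 := hp s hs hsF
      have h2 := hp t ht htF
      by_cases hts : t ∈ up F s
      · rw [mu_eq_zero hts (hS.sub _ _ ((ihG s hsF).subN _ h1.1))]
        have : s ∈ up F t := by
          rw [up_eq_of_mem htF hts]; exact mem_up _ _
        rw [mu_eq_zero this (hS.sub _ _ ((ihG t htF).subN _ h2.1))]
      · have hst := (not_mem_up_iff hsF hts).2
        have k1 := (ihG s hsF).cN _ t ht hts _ h1.1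
        have k2 := (ihG t htF).cN _ s hs hst _ h2.1
        have k3 := (ihG s hsF).cR _ t ht hts _ h1.2
        have k4 := (ihG t htF).cR _ s hs hst _ h2.2
        rw [up_comm] at k2 k4
        have h3 := (ihG2 s hsF t hts).disj _ (mu t (p s) - mu s (p t)) (sub_mem k1 k2) (by
          have := sub_mem k4 k3
          rw [map_sub, map_sub, mu_comm t s] at this
          have e3 : mu s (mu t a) - mu s (p t) - (mu s (mu t a) - mu t (p s)) =
            mu t (p s) - mu s (p t) := by abel
          rwa [e3] at this)
        exact sub_eq_zero.1 h3
    · rintro b ⟨hb, hb2⟩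
      refine ⟨b, (mem_NN_low hF hw).2 ⟨hb, fun s hs hsF => ?_⟩, a - b,
        (mem_RR_low hF hw).2 ⟨sub_mem ha hb, fun s hs hsF => ?_⟩, by abel⟩
      · rw [hb2 s hs hsF]; exact (hp s hs hsF).1
      · rw [map_sub, hb2 s hs hsF]; exact (hp s hs hsF).2
  have LN : ∀ w, ∀ a ∈ NN S' N F w, Lc (ind S') a ∈ NN S' N F (w+1) := by
    intro w a ha
    rw [Lc_apply]
    refine Submodule.sum_mem _ fun v _ => ?_
    by_cases hv : v ∈ S'
    · refine Submodule.smul_mem _ _ ?_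
      by_cases hvF : v ∈ F
      · rw [mu_eq_zero hvF (hS.sub _ _ (subN _ ha))]; exact zero_mem _
      · exact bN _ v hv hvF (cN _ v hv hvF a ha)
    · simp [ind, hv]
  have LR : ∀ w, ∀ a ∈ RR S' N F w, Lc (ind S') a ∈ RR S' N F (w+1) := by
    intro w a ha
    rw [Lc_apply]
    refine Submodule.sum_mem _ fun v _ => ?_
    by_cases hv : v ∈ S'
    · refine Submodule.smul_mem _ _ ?_
      by_cases hvF : v ∈ F
      · rw [mu_eq_zero hvF (hS.sub _ _ (subR _ ha))]; exact zero_mem _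
      · exact bR _ v hv hvF (cR _ v hv hvF a ha)
    · simp [ind, hv]
  have disjm : ∀ w, 2 * w = finrank K V + rk F → ∀ a ∈ NN S' N F w, a ∈ RR S' N F w → a = 0 := by
    intro w hw a ha ha'
    by_contra h0
    have haN := subN _ ha
    have := hr_erase hS hn hspan F w 0 (by omega) a haN ?_ h0
    · rw [pow_zero, Module.End.one_apply, orth w w (by omega) a ha a ha', mul_zero] at this
      exact lt_irrefl _ this
    · intro w' hw' u hu
      rw [zero_add, pow_one, pp_Lc_symm _ (hS.sub _ _ haN) (hS.sub _ _ hu)]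
      obtain ⟨u1, hu1, u2, hu2, rfl⟩ := supl w' (by omega) u hu
      have k1 := LN _ u1 hu1
      have k2 := LR _ u2 hu2
      rw [hw'] at k1 k2
      rw [map_add, map_add, orth w w (by omega) a ha _ k2, pp_symm,
        orth w w (by omega) _ k1 a ha', add_zero]
  have disj : ∀ w, ∀ a ∈ NN S' N F w, a ∈ RR S' N F w → a = 0 := by
    intro w a ha ha'
    rcases lt_trichotomy (2 * w) (finrank K V + rk F) with hw | hw | hw
    · exact disjl w hw a ha ha'
    · exact disjm w hw a ha ha'
    · by_cases hfar : finrank K V + rk F < w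
      · exact farz w hfar F a (subN _ ha)
      obtain ⟨w', hw'⟩ : ∃ w', w + w' = finrank K V + rk F := ⟨finrank K V + rk F - w, by omega⟩
      refine hS.nd F w w' hw' a (subN _ ha) fun b hb => ?_
      obtain ⟨b1, hb1, b2, hb2, rfl⟩ := supl w' (by omega) b hb
      rw [map_add, orth w w' hw' a ha b2 hb2, pp_symm, orth w' w (by omega) b1 hb1 a ha', add_zero]
  have sup : ∀ w, ∀ a ∈ N F w, ∃ b ∈ NN S' N F w, ∃ c ∈ RR S' N F w, a = b + c := by
    intro w a ha
    rcases lt_trichotomy (2 * w) (finrank K V + rk F) with hw | hw | hw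
    · exact supl w hw a ha
    · have hnd : ∀ x ∈ NN S' N F w, (∀ y ∈ NN S' N F w, pp F x y = 0) → x = 0 := fun x hx h =>
        disj w x hx ((mem_RR_mid hF hw).2 ⟨subN _ hx, h⟩)
      obtain ⟨b, hb, hb2⟩ := represent (NN S' N F w) (NN S' N F w) (pp F) hnd
        (fun x hx h => hnd x hx fun y hy => by rw [pp_symm]; exact h y hy) (pp F a)
      refine ⟨b, hb, a - b, (mem_RR_mid hF hw).2 ⟨sub_mem ha (subN _ hb), fun c hc => ?_⟩, by abel⟩
      rw [map_sub, LinearMap.sub_apply, hb2 c hc, sub_self]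
    · by_cases hfar : finrank K V + rk F < w
      · exact ⟨0, zero_mem _, 0, zero_mem _, by rw [farz w hfar F a ha, add_zero]⟩
      obtain ⟨w', hw'⟩ : ∃ w', w + w' = finrank K V + rk F := ⟨finrank K V + rk F - w, by omega⟩
      obtain ⟨f, hf1, hf2⟩ := exists_proj (NN S' N F w') (RR S' N F w') (disj w')
      obtain ⟨b, hb, hb2⟩ := represent (N F w) (N F w') (pp F) (hS.nd F w w' hw')
        (fun x hx h => hS.nd F w' w (by omega) x hx fun y hy => by rw [pp_symm]; exact h y hy)
        (pp F a ∘ₗ f)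
      refine ⟨b, (mem_NN_high hF hw' (by omega)).2 ⟨hb, fun c hc => ?_⟩, a - b,
        (mem_RR_high hF hw' (by omega)).2 ⟨sub_mem ha hb, fun c hc => ?_⟩, by abel⟩
      · rw [hb2 c (subR _ hc), LinearMap.comp_apply, hf2 c hc, map_zero]
      · rw [map_sub, LinearMap.sub_apply, hb2 c (subN _ hc), LinearMap.comp_apply, hf1 c hc,
          sub_self]
  exact ⟨subN, subR, orth, sup, disj, bN, bR, cN, cR⟩

open Classical in
theorem good_all (hS : Sys S N) {n : V} (hn : n ∈ S)
    (hspan : Submodule.span K ((S.erase n : Finset V) : Set V) = ⊤) (k : ℕ) :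
    ∀ F : Submodule K V, finrank K V - rk F = k → Good (S.erase n) N F := by
  induction k using Nat.strong_induction_on with
  | _ k ih =>
  intro F hk
  by_cases hF : F = ⊤
  · subst hF; exact good_top
  · refine good_step hS hn hspan hF fun G hG => ih (finrank K V - rk G) ?_ G rfl
    have := rk_lt hF
    omega

open Classical in
theorem sys_erase (hS : Sys S N) {n : V} (hn : n ∈ S)
    (hspan : Submodule.span K ((S.erase n : Finset V) : Set V) = ⊤) :
    Sys (S.erase n) (NN (S.erase n) N) := by
  have hG : ∀ F, Good (S.erase n) N F := fun F => good_all hS hn hspan _ F rfl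
  have hsub : ∀ s ∈ S.erase n, s ∈ S := fun s hs => Finset.mem_of_mem_erase hs
  have hPre : Pre (S.erase n) (NN (S.erase n) N) := by
    refine ⟨fun F w a ha => hS.sub _ _ ((hG F).subN _ ha), fun F w s hs => ?_, fun F w s hs a ha => ?_⟩
    · by_cases hsF : s ∈ F
      · rw [up_eq_self hsF]
      · exact (hG F).bN w s hs hsF
    · by_cases hsF : s ∈ F
      · rw [mu_eq_zero hsF (hS.sub _ _ ((hG F).subN _ ha))]; exact zero_mem _
      · exact (hG F).cN w s hs hsF a ha
  have nd : ∀ F w w', w + w' = finrank K V + rk F → ∀ a ∈ NN (S.erase n) N F w,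
      (∀ b ∈ NN (S.erase n) N F w', pp F a b = 0) → a = 0 := by
    intro F w w' hw a ha h
    refine hS.nd F w w' hw a ((hG F).subN _ ha) fun b hb => ?_
    obtain ⟨b1, hb1, b2, hb2, rfl⟩ := (hG F).sup w' b hb
    rw [map_add, h b1 hb1, (hG F).orth w w' hw a ha b2 hb2, add_zero]
  have one : ∀ k, ∀ F : Submodule K V, finrank K V - rk F = k →
      ee F ∈ NN (S.erase n) N F (rk F) := by
    intro k
    induction k using Nat.strong_induction_on with
    | _ k ih =>
    intro F hk
    by_cases hF : F = ⊤
    · subst hF; rw [NN_top]; exact hS.one ⊤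
    · have := rk_lt hF
      refine (mem_NN_low hF (by omega)).2 ⟨hS.one F, fun s hs hsF => ?_⟩
      rw [mu_ee_not_mem hsF, ← rk_up hsF]
      exact ih _ (by rw [rk_up hsF]; omega) _ rfl
  refine ⟨hPre, hspan, fun F => one _ F rfl, nd, ?_, ?_, ?_⟩
  · intro F w hF hw a ha h
    rcases lt_or_eq_of_le hw with hw | hw
    · exact inj_erase hS hn hspan hw ((hG F).subN _ ha) h
    · refine nd F w w (by omega) a ha fun b hb => ?_
      have : NN (S.erase n) N F w ≤ LinearMap.ker (pp F a) := by
        refine NN_mid_induction hF hw fun t ht htF b hb => ?_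
        rw [LinearMap.mem_ker, pp_adj htF (hPre.sub _ _ ha) (hPre.sub _ _ hb), h t ht]
        simp
      exact this hb
  · intro F w hF g h1 h2 h3
    obtain ⟨a, ha, ha2⟩ := lim_erase hS hn hspan w hF g
      (fun s hs hsF => (hG _).subN _ (h1 s hs hsF)) h2 h3
    obtain ⟨b, hb, c, hc, rfl⟩ := (hG F).sup w a ha
    refine ⟨b, hb, fun s hs hsF => ?_⟩
    have e := ha2 s hs hsF
    rw [map_add] at e
    have : mu s c = 0 := by
      refine (hG (up F s)).disj (w+1) _ ?_ ((hG F).cR w s hs hsF c hc)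
      have := sub_mem (h1 s hs hsF) ((hG F).cN w s hs hsF b hb)
      rwa [← e, add_sub_cancel_left] at this
    rw [← e, this, add_zero]
  · intro F w σ hw a ha hp h0
    refine hr_erase hS hn hspan F w σ hw a ((hG F).subN _ ha) ?_ h0
    intro w' hw' u hu
    obtain ⟨u1, hu1, u2, hu2, rfl⟩ := (hG F).sup w' u hu
    rw [map_add, hp w' hw' u1 hu1, zero_add]
    refine (hG F).orth (w + (σ + 1)) w' (by omega) _ (hPre.Lpow_mem ?_ _ ha) u2 hu2
    intro v hv
    by_contra h
    simp only [ind, if_neg h] at hv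
    exact hv rfl

open Classical in
/-- all the way down -/
theorem sys_down (S₀ : Finset V) (hspan : Submodule.span K (S₀ : Set V) = ⊤) (k : ℕ) :
    ∀ (S : Finset V) (N : Submodule K V → ℕ → Submodule ℝ (Submodule K V → ℝ)),
    S₀ ⊆ S → (S \ S₀).card = k → Sys S N → ∃ N' : Submodule K V → ℕ →
      Submodule ℝ (Submodule K V → ℝ), Sys S₀ N' := by
  induction k with
  | zero =>
    intro S N h hk hS
    have : S = S₀ := by
      apply Finset.Subset.antisymm _ h
      rw [Finset.card_eq_zero, Finset.sdiff_eq_empty_iff_subset] at hk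
      exact hk
    subst this
    exact ⟨N, hS⟩
  | succ k ih =>
    intro S N h hk hS
    obtain ⟨n, hn⟩ := Finset.card_pos.1 (by omega : 0 < (S \ S₀).card)
    rw [Finset.mem_sdiff] at hn
    have hsub : S₀ ⊆ S.erase n := fun x hx =>
      Finset.mem_erase.2 ⟨fun e => hn.2 (e ▸ hx), h hx⟩
    refine ih (S.erase n) (NN (S.erase n) N) hsub ?_ (sys_erase hS hn.1 ?_)
    · rw [Finset.erase_sdiff_comm, Finset.card_erase_of_mem (Finset.mem_sdiff.2 hn)]; omega
    · rw [eq_top_iff, ← hspan]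
      exact Submodule.span_mono (by exact_mod_cast hsub)

end Split2
end TopHeavy

namespace TopHeavy
open Module

section Init
variable {K V : Type} [Field K] [AddCommGroup V] [Module K V] [Finite V] [Fintype V]

open Classical in
/-- number of vectors outside a subspace -/
noncomputable def ov (U : Submodule K V) : ℝ := ∑ v : V, if v ∈ U then 0 else 1

open Classical in
theorem ov_eq_card (U : Submodule K V) : ov U = (Nat.card V : ℝ) - Nat.card U := by
  have h1 : ov U = ∑ v : V, ((1 : ℝ) - if v ∈ U then 1 else 0) := by
    unfold ov
    exact Finset.sum_congr rfl fun v _ => by split_ifs <;> simp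
  rw [h1, Finset.sum_sub_distrib, Finset.sum_boole]
  simp only [Finset.sum_const, Finset.card_univ, nsmul_eq_mul, mul_one, Nat.card_eq_fintype_card]
  congr 2
  rw [Fintype.card_subtype]

theorem ov_congr {U W : Submodule K V} (h : rk U = rk W) : ov U = ov W := by
  rw [ov_eq_card, ov_eq_card]
  have e : U ≃ₗ[K] W := LinearEquiv.ofFinrankEq _ _ h
  rw [Nat.card_congr e.toEquiv]

open Classical in
theorem ov_pos {U : Submodule K V} (h : U ≠ ⊤) : 0 < ov U := by
  obtain ⟨v, hv⟩ : ∃ v, v ∉ U := by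
    by_contra! h'
    exact h (eq_top_iff.2 fun v _ => h' v)
  unfold ov
  refine Finset.sum_pos' (fun v _ => by split_ifs <;> norm_num) ⟨v, Finset.mem_univ _, ?_⟩
  rw [if_neg hv]; norm_num

open Classical in
theorem cnt_eq {X U : Submodule K V} (h : X ≤ U) :
    (∑ v : V, if v ∉ X ∧ v ∈ U then (1 : ℝ) else 0) = ov X - ov U := by
  unfold ov
  rw [← Finset.sum_sub_distrib]
  refine Finset.sum_congr rfl fun v _ => ?_
  by_cases h1 : v ∈ X
  · simp [h1, h h1]
  · by_cases h2 : v ∈ U <;> simp [h1, h2]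

open Classical in
theorem cnt_pos {X U : Submodule K V} (h : X < U) : 0 < ov X - ov U := by
  rw [← cnt_eq h.le]
  obtain ⟨v, hvU, hvX⟩ := SetLike.exists_of_lt h
  refine Finset.sum_pos' (fun v _ => by split_ifs <;> norm_num) ⟨v, Finset.mem_univ _, ?_⟩
  rw [if_pos ⟨hvX, hvU⟩]; norm_num

/-- weights all one -/
noncomputable def c1 : V → ℝ := ind Finset.univ

theorem c1_apply (v : V) : c1 v = 1 := by simp [c1, ind]

theorem up_inf_iff {F U W : Submodule K V} {v : V} (hFU : F ≤ U) (hFW : F ≤ W) (hv : v ∉ U) :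
    up U v ⊓ W = F ↔ U ⊓ W = F ∧ v ∉ U ⊔ W := by
  have e : up U v ⊔ W = up (U ⊔ W) v := by unfold up; rw [sup_right_comm]
  have m1 := rk_modular (up U v) W
  have m2 := rk_modular U W
  rw [e, rk_up hv] at m1
  constructor
  · intro h
    have h1 : U ⊓ W = F :=
      le_antisymm (h ▸ inf_le_inf_right W (le_up U v)) (le_inf hFU hFW)
    refine ⟨h1, fun h2 => ?_⟩
    rw [up_eq_self h2, h] at m1
    rw [h1] at m2
    omega
  · rintro ⟨h1, h2⟩
    rw [rk_up h2] at m1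
    rw [h1] at m2
    exact (rk_eq_of_le (le_inf (hFU.trans (le_up _ _)) hFW) (by omega)).symm

open Classical in
theorem T_formula (F : Submodule K V) (r : ℕ) : ∃ κ : ℝ, 0 < κ ∧ ∀ U W : Submodule K V, F ≤ U → F ≤ W →
    rk U + rk W + r = finrank K V + rk F →
    pp F ((Lc c1 ^ r) (ee U)) (ee W) = if U ⊓ W = F then κ else 0 := by
  induction r with
  | zero =>
    refine ⟨1, one_pos, fun U W hU hW hr => ?_⟩
    rw [pow_zero, Module.End.one_apply, pp_ee]
    have m := rk_modular U W
    by_cases h : U ⊓ W = F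
    · have : U ⊔ W = ⊤ := by
        apply eq_top_of_rk; rw [h] at m; omega
      simp [h, this]
    · simp [h]
  | succ r ih =>
    obtain ⟨κ, hκ, ih⟩ := ih
    have step : ∀ U W : Submodule K V, F ≤ U → F ≤ W → rk U + rk W + (r+1) = finrank K V + rk F →
        pp F ((Lc c1 ^ (r+1)) (ee U)) (ee W) = if U ⊓ W = F then κ * ov (U ⊔ W) else 0 := by
      intro U W hU hW hr
      rw [Lpow_succ', Lc_apply, map_sum, map_sum, LinearMap.sum_apply]
      have : ∀ v : V, pp F ((Lc c1 ^ r) (c1 v • mu v (ee U))) (ee W) =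
          if U ⊓ W = F then (κ * if v ∈ U ⊔ W then 0 else 1) else 0 := by
        intro v
        rw [c1_apply, one_smul]
        by_cases hv : v ∈ U
        · rw [mu_ee_mem hv, if_pos ((le_sup_left : U ≤ U ⊔ W) hv)]; simp
        · rw [mu_ee_not_mem hv, ih _ _ (hU.trans (le_up _ _)) hW (by rw [rk_up hv]; omega)]
          have := up_inf_iff hU hW hv
          by_cases h1 : U ⊓ W = F
          · by_cases h2 : v ∈ U ⊔ W
            · rw [if_neg (by rw [this]; tauto), if_pos h1, if_pos h2, mul_zero]
            · rw [if_pos (by rw [this]; tauto), if_pos h1, if_neg h2, mul_one]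
          · rw [if_neg (by rw [this]; tauto), if_neg h1]
      rw [Finset.sum_congr rfl fun v _ => this v]
      by_cases h1 : U ⊓ W = F
      · simp only [if_pos h1]
        rw [← Finset.mul_sum]; rfl
      · simp [if_neg h1]
    by_cases hex : ∃ U₀ W₀ : Submodule K V, F ≤ U₀ ∧ F ≤ W₀ ∧
        rk U₀ + rk W₀ + (r+1) = finrank K V + rk F ∧ U₀ ⊓ W₀ = F
    · obtain ⟨U₀, W₀, h1, h2, h3, h4⟩ := hex
      have m0 := rk_modular U₀ W₀
      rw [h4] at m0
      refine ⟨κ * ov (U₀ ⊔ W₀), mul_pos hκ (ov_pos ?_), fun U W hU hW hr => ?_⟩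
      · intro h
        rw [h, rk_top] at m0; omega
      · rw [step U W hU hW hr]
        by_cases h : U ⊓ W = F
        · have m := rk_modular U W
          rw [h] at m
          rw [if_pos h, if_pos h, ov_congr (show rk (U ⊔ W) = rk (U₀ ⊔ W₀) by omega)]
        · rw [if_neg h, if_neg h]
    · refine ⟨1, one_pos, fun U W hU hW hr => ?_⟩
      rw [step U W hU hW hr, if_neg, if_neg] <;>
      exact fun h => hex ⟨U, W, hU, hW, hr, h⟩

open Classical in
/-- sum over subspaces meeting `W` in `F` -/
noncomputable def fL (F W : Submodule K V) : (Submodule K V → ℝ) →ₗ[ℝ] ℝ :=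
  ∑ U ∈ Finset.univ.filter (fun U => U ⊓ W = F), LinearMap.proj U

open Classical in
theorem fL_apply (F W : Submodule K V) (a : Submodule K V → ℝ) :
    fL F W a = ∑ U ∈ Finset.univ.filter (fun U => U ⊓ W = F), a U := by
  simp [fL]

open Classical in
theorem fL_ee (F W U : Submodule K V) : fL F W (ee U) = if U ⊓ W = F then 1 else 0 := by
  rw [fL_apply]
  simp only [ee, Finset.sum_filter]
  rw [Finset.sum_eq_single U]
  · simp
  · intro U' _ h; simp [Pi.single_apply, h]
  · simp

open Classical in
theorem pp_formula (F : Submodule K V) (r : ℕ) : ∃ κ : ℝ, 0 < κ ∧ ∀ w, ∀ a ∈ AF F w, ∀ W, F ≤ W →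
    w + rk W + r = finrank K V + rk F → pp F ((Lc c1 ^ r) a) (ee W) = κ * fL F W a := by
  obtain ⟨κ, hκ, h⟩ := T_formula F r
  refine ⟨κ, hκ, fun w a ha W hW hr => ?_⟩
  refine AF_induction (((pp F).flip (ee W)) ∘ₗ (Lc c1 ^ r)) (κ • fL F W) (fun U hU hw => ?_) ha
  simp only [LinearMap.comp_apply, LinearMap.flip_apply, LinearMap.smul_apply, smul_eq_mul]
  rw [h U W hU hW (by rw [hw]; exact hr), fL_ee]
  split_ifs <;> simp

open Classical in
/-- total mass above `X` -/
noncomputable def sX (a : Submodule K V → ℝ) (X : Submodule K V) : ℝ :=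
  ∑ U ∈ Finset.univ.filter (fun U => X ≤ U), a U

open Classical in
theorem f_zero {a : Submodule K V → ℝ} {w : ℕ} (k : ℕ) : ∀ F W : Submodule K V, F ≤ W → rk W = rk F + k →
    rk W < w → (∀ X, F ≤ X → rk X < w → sX a X = 0) → fL F W a = 0 := by
  induction k using Nat.strong_induction_on with
  | _ k ih =>
  intro F W hFW hk hW H
  have e := Finset.sum_fiberwise_of_maps_to (s := Finset.univ.filter (fun U => F ≤ U))
    (t := Finset.univ.filter (fun P => F ≤ P ∧ P ≤ W)) (g := fun U => U ⊓ W) (by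
      intro U hU
      simp only [Finset.mem_filter, Finset.mem_univ, true_and] at hU ⊢
      exact ⟨le_inf hU hFW, inf_le_right⟩) a
  have h0 := H F le_rfl (by omega)
  unfold sX at h0
  rw [h0] at e
  have hterm : ∀ P ∈ Finset.univ.filter (fun P => F ≤ P ∧ P ≤ W),
      (∑ U ∈ (Finset.univ.filter (fun U => F ≤ U)).filter (fun U => U ⊓ W = P), a U) =
      fL P W a := by
    intro P hP
    simp only [Finset.mem_filter, Finset.mem_univ, true_and] at hP
    rw [fL_apply]
    refine Finset.sum_congr ?_ fun _ _ => rfl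
    ext U
    simp only [Finset.mem_filter, Finset.mem_univ, true_and]
    exact ⟨fun h => h.2, fun h => ⟨hP.1.trans (h ▸ inf_le_left), h⟩⟩
  rw [Finset.sum_congr rfl hterm] at e
  rw [Finset.sum_eq_single F] at e
  · exact e
  · intro P hP hPF
    simp only [Finset.mem_filter, Finset.mem_univ, true_and] at hP
    have h1 : rk F < rk P := by
      by_contra h
      exact hPF (rk_eq_of_le hP.1 (by omega)).symm
    have h2 := rk_mono hP.2
    exact ih (rk W - rk P) (by omega) P W hP.2 (by omega) hW fun X hX => H X (hP.1.trans hX)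
  · intro h
    exfalso; apply h
    simp [hFW]

open Classical in
theorem f_sign {a : Submodule K V → ℝ} {w : ℕ} (ha : ∀ U, a U ≠ 0 → rk U = w) (k : ℕ) :
    ∀ F W : Submodule K V, F ≤ W → rk W = rk F + k →
    rk W = w → (∀ X, F ≤ X → rk X < w → sX a X = 0) →
    ∃ ν : ℝ, 0 < ν ∧ fL F W a = (-1) ^ k * ν * a W := by
  induction k with
  | zero =>
    intro F W hFW hk hW H
    obtain rfl := rk_eq_of_le hFW (by omega)
    refine ⟨1, one_pos, ?_⟩
    rw [fL_apply, Finset.sum_eq_single F]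
    · simp
    · intro U hU hUF
      simp only [Finset.mem_filter, Finset.mem_univ, true_and] at hU
      by_contra h0
      have := ha U h0
      exact hUF (rk_eq_of_le (inf_eq_right.1 hU) (by omega)).symm
    · intro h; exfalso; apply h; simp
  | succ k ih =>
    intro F W hFW hk hW H
    have hlt : F < W := lt_of_le_of_ne hFW (fun h => by rw [h] at hk; omega)
    obtain ⟨W', hFW', hcov⟩ := exists_le_covBy_of_lt hlt
    obtain ⟨v, hvW, hvW'⟩ := SetLike.exists_of_lt hcov.lt
    have hWW' : up W' v = W := by
      rcases hcov.eq_or_eq (le_up W' v) (up_le hcov.le hvW) with h | h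
      · exact absurd (h ▸ mem_up W' v) hvW'
      · exact h
    have hrk : rk W = rk W' + 1 := by rw [← hWW', rk_up hvW']
    have h0 := f_zero (a := a) (w := w) (rk W' - rk F) F W' hFW' (by have := rk_mono hFW'; omega)
      (by omega) H
    rw [fL_apply] at h0
    have e := Finset.sum_fiberwise_of_maps_to (s := Finset.univ.filter (fun U => U ⊓ W' = F))
      (t := Finset.univ.filter (fun P => P ⊓ W' = F ∧ P ≤ W)) (g := fun U => U ⊓ W) (by
        intro U hU
        simp only [Finset.mem_filter, Finset.mem_univ, true_and] at hU ⊢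
        refine ⟨?_, inf_le_right⟩
        rw [inf_assoc, inf_eq_right.2 hcov.le]; exact hU) a
    rw [h0] at e
    have hterm : ∀ P ∈ Finset.univ.filter (fun P => P ⊓ W' = F ∧ P ≤ W),
        (∑ U ∈ (Finset.univ.filter (fun U => U ⊓ W' = F)).filter (fun U => U ⊓ W = P), a U) =
        fL P W a := by
      intro P hP
      simp only [Finset.mem_filter, Finset.mem_univ, true_and] at hP
      rw [fL_apply]
      refine Finset.sum_congr ?_ fun _ _ => rfl
      ext U
      simp only [Finset.mem_filter, Finset.mem_univ, true_and]
      refine ⟨fun h => h.2, fun h => ⟨?_, h⟩⟩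
      rw [← hP.1, ← h, inf_assoc, inf_eq_right.2 hcov.le]
    rw [Finset.sum_congr rfl hterm] at e
    have hFt : F ∈ Finset.univ.filter (fun P => P ⊓ W' = F ∧ P ≤ W) := by
      simp [hFW, hFW']
    rw [← Finset.add_sum_erase _ _ hFt] at e
    have hex : ∀ P : Submodule K V, ∃ ν : ℝ, P ∈ (Finset.univ.filter (fun P => P ⊓ W' = F ∧ P ≤ W)).erase F →
        0 < ν ∧ fL P W a = (-1) ^ k * ν * a W := by
      intro P
      by_cases hP : P ∈ (Finset.univ.filter (fun P => P ⊓ W' = F ∧ P ≤ W)).erase F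
      · have hP' := hP
        simp only [Finset.mem_erase, Finset.mem_filter, Finset.mem_univ, true_and] at hP'
        obtain ⟨hPF, hPW', hPW⟩ := hP'
        have hFP : F ≤ P := hPW' ▸ inf_le_left
        have h1 : rk F < rk P := by
          by_contra h
          exact hPF (rk_eq_of_le hFP (by omega)).symm
        have m := rk_modular P W'
        have h2 := rk_mono (sup_le hPW hcov.le)
        rw [hPW'] at m
        obtain ⟨ν, hν, h⟩ := ih P W hPW (by omega) hW fun X hX => H X (hFP.trans hX)
        exact ⟨ν, fun _ => ⟨hν, h⟩⟩
      · exact ⟨0, fun h => absurd h hP⟩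
    choose ν hν using hex
    refine ⟨∑ P ∈ (Finset.univ.filter (fun P => P ⊓ W' = F ∧ P ≤ W)).erase F, ν P, ?_, ?_⟩
    · refine Finset.sum_pos (fun P hP => (hν P hP).1) ⟨up F v, ?_⟩
      have hvF : v ∉ F := fun h => hvW' (hFW' h)
      simp only [Finset.mem_erase, Finset.mem_filter, Finset.mem_univ, true_and]
      refine ⟨fun h => hvF (h ▸ mem_up F v), ?_, up_le hFW hvW⟩
      have h1 : up F v ⊓ W' < up F v := by
        refine lt_of_le_of_ne inf_le_left fun h => hvW' ?_
        exact (inf_eq_left.1 h) (mem_up F v)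
      have h2 : rk (up F v ⊓ W') < rk (up F v) := by
        by_contra h
        exact h1.ne (rk_eq_of_le h1.le (by omega))
      rw [rk_up hvF] at h2
      exact (rk_eq_of_le (le_inf (le_up _ _) hFW') (by omega)).symm
    · rw [Finset.sum_congr rfl fun P hP => (hν P hP).2] at e
      rw [Finset.mul_sum, Finset.sum_mul]
      rw [eq_neg_of_add_eq_zero_left e, ← Finset.sum_neg_distrib]
      exact Finset.sum_congr rfl fun P _ => by ring

open Classical in
theorem sX_rec {a : Submodule K V → ℝ} {w : ℕ} (ha : ∀ U, a U ≠ 0 → rk U = w) {X : Submodule K V}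
    (hX : rk X < w) (h : (∑ v : V, if v ∈ X then 0 else sX a (up X v)) = 0) : sX a X = 0 := by
  by_contra hne
  obtain ⟨U₀, hU₀, ha0⟩ := Finset.exists_ne_zero_of_sum_ne_zero hne
  simp only [Finset.mem_filter, Finset.mem_univ, true_and] at hU₀
  have hrk0 := ha U₀ ha0
  have hlt : X < U₀ := lt_of_le_of_ne hU₀ (fun e => by rw [e] at hX; omega)
  have key : (∑ v : V, if v ∈ X then 0 else sX a (up X v)) = (ov X - ov U₀) * sX a X := by
    have e1 : ∀ v : V, (if v ∈ X then 0 else sX a (up X v)) =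
        ∑ U ∈ Finset.univ.filter (fun U => X ≤ U), (if v ∉ X ∧ v ∈ U then 1 else 0) * a U := by
      intro v
      by_cases hv : v ∈ X
      · simp [hv]
      · rw [if_neg hv]
        unfold sX
        rw [Finset.sum_filter, Finset.sum_filter]
        refine Finset.sum_congr rfl fun U _ => ?_
        by_cases h1 : X ≤ U
        · by_cases h2 : v ∈ U
          · simp [hv, h1, h2, up_le h1 h2]
          · have : ¬ up X v ≤ U := fun h => h2 (h (mem_up _ _))
            simp [h2, this]
        · have : ¬ up X v ≤ U := fun h => h1 ((le_up _ _).trans h)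
          simp [h1, this]
    rw [Finset.sum_congr rfl fun v _ => e1 v, Finset.sum_comm]
    unfold sX
    rw [Finset.mul_sum]
    refine Finset.sum_congr rfl fun U hU => ?_
    simp only [Finset.mem_filter, Finset.mem_univ, true_and] at hU
    rw [← Finset.sum_mul, cnt_eq hU]
    by_cases h0 : a U = 0
    · simp [h0]
    · rw [ov_congr (show rk U = rk U₀ by rw [ha U h0, hrk0])]
  rw [key] at h
  rcases mul_eq_zero.1 h with h | h
  · have := cnt_pos hlt; linarith
  · exact hne h

/-- euclidean pairing -/
noncomputable def dotp : (Submodule K V → ℝ) →ₗ[ℝ] (Submodule K V → ℝ) →ₗ[ℝ] ℝ :=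
  LinearMap.mk₂ ℝ (fun a b => ∑ U, a U * b U)
    (by intro a a' b; simp [add_mul, Finset.sum_add_distrib])
    (by intro c a b; simp [Finset.mul_sum, mul_assoc])
    (by intro a b b'; simp [mul_add, Finset.sum_add_distrib])
    (by intro c a b; simp [Finset.mul_sum, mul_left_comm])

theorem dotp_apply (a b : Submodule K V → ℝ) : dotp a b = ∑ U, a U * b U := rfl

theorem dotp_self {a : Submodule K V → ℝ} (h : dotp a a = 0) : a = 0 := by
  rw [dotp_apply] at h
  funext U
  have := (Finset.sum_eq_zero_iff_of_nonneg fun U _ => mul_self_nonneg (a U)).1 h U (Finset.mem_univ _)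
  simpa using this

theorem dotp_ee (a : Submodule K V → ℝ) (U : Submodule K V) : dotp a (ee U) = a U := by
  classical
  rw [dotp_apply]
  simp [ee, Pi.single_apply]

open Classical in
theorem H_of_orth {F : Submodule K V} {a : Submodule K V → ℝ} {w : ℕ} (ha : ∀ U, a U ≠ 0 → rk U = w)
    (h : ∀ W, F ≤ W → rk W + 1 = w → dotp a (Lc c1 (ee W)) = 0) (k : ℕ) :
    ∀ X, F ≤ X → rk X + 1 + k = w → sX a X = 0 := by
  induction k with
  | zero =>
    intro X hX hw
    apply sX_rec ha (by omega)
    have h' := h X hX (by omega)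
    rw [Lc_apply, map_sum] at h'
    refine Eq.trans (Finset.sum_congr rfl fun v _ => ?_) h'
    rw [c1_apply, one_smul]
    by_cases hv : v ∈ X
    · rw [if_pos hv, mu_ee_mem hv, map_zero]
    · rw [if_neg hv, mu_ee_not_mem hv, dotp_ee]
      unfold sX
      rw [Finset.sum_eq_single (up X v)]
      · intro U hU hne
        simp only [Finset.mem_filter, Finset.mem_univ, true_and] at hU
        by_contra h0
        have := ha U h0
        exact hne (rk_eq_of_le hU (by rw [rk_up hv]; omega)).symm
      · intro h; exfalso; apply h; simp
  | succ k ih =>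
    intro X hX hw
    apply sX_rec ha (by omega)
    refine Finset.sum_eq_zero fun v _ => ?_
    by_cases hv : v ∈ X
    · rw [if_pos hv]
    · rw [if_neg hv]
      exact ih _ (hX.trans (le_up _ _)) (by rw [rk_up hv]; omega)

open Classical in
theorem decomp (F : Submodule K V) (w : ℕ) (a : Submodule K V → ℝ) (ha : a ∈ AF F w) :
    ∃ a₁ ∈ AF F w, ∃ y, a = a₁ + y ∧ (∀ X, F ≤ X → rk X < w → sX a₁ X = 0) ∧
      (y = 0 ∨ ∃ w', w' + 1 = w ∧ ∃ b ∈ AF F w', y = Lc c1 b) := by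
  cases w with
  | zero => exact ⟨a, ha, 0, by simp, fun X _ h => absurd h (by omega), Or.inl rfl⟩
  | succ w =>
    let P := (AF F w).map (Lc c1)
    have hnd : ∀ x ∈ P, (∀ y ∈ P, dotp x y = 0) → x = 0 := fun x hx h => dotp_self (h x hx)
    have hcomm : ∀ x y : Submodule K V → ℝ, dotp x y = dotp y x := fun x y => by
      rw [dotp_apply, dotp_apply]; exact Finset.sum_congr rfl fun _ _ => mul_comm _ _
    obtain ⟨y, hy, hy2⟩ := represent P P dotp hnd
      (fun x hx h => hnd x hx fun z hz => by rw [hcomm]; exact h z hz) (dotp a)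
    obtain ⟨b, hb, rfl⟩ := hy
    have ha1 : a - Lc c1 b ∈ AF F (w+1) := sub_mem ha (Lc_mem hb)
    refine ⟨a - Lc c1 b, ha1, Lc c1 b, by abel, ?_, Or.inr ⟨w, rfl, b, hb, rfl⟩⟩
    intro X hX hXw
    refine H_of_orth (F := F) (w := w+1) (fun U h => (ha1 U h).2) ?_ (w - rk X) X hX (by omega)
    intro W hW hWw
    rw [map_sub, LinearMap.sub_apply, hy2 _ ⟨ee W, ee_mem' hW (by omega), rfl⟩, sub_self]

theorem lowprim {F : Submodule K V} {w w' σ : ℕ} {a : Submodule K V → ℝ} (ha : a ∈ AF F w)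
    (H : ∀ X, F ≤ X → rk X < w → sX a X = 0) (hw : w + w' + σ = finrank K V + rk F) (hlt : w' < w)
    {u : Submodule K V → ℝ} (hu : u ∈ AF F w') : pp F ((Lc c1 ^ σ) a) u = 0 := by
  obtain ⟨κ, hκ, h⟩ := pp_formula F σ
  refine AF_induction (pp F ((Lc c1 ^ σ) a)) 0 (fun W hW hWw => ?_) hu
  rw [h w a ha W hW (by omega), f_zero (w := w) (rk W - rk F) F W hW
    (by have := rk_mono hW; omega) (by omega) H]
  simp

theorem prim_sign {F : Submodule K V} {w σ : ℕ} {a : Submodule K V → ℝ} (ha : a ∈ AF F w)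
    (H : ∀ X, F ≤ X → rk X < w → sX a X = 0) (hw : 2 * w + σ = finrank K V + rk F) (h0 : a ≠ 0) :
    0 < (-1 : ℝ) ^ (w + rk F) * pp F ((Lc c1 ^ σ) a) a := by
  obtain ⟨κ, hκ, h⟩ := pp_formula F σ
  have hterm : ∀ W, ∃ ν : ℝ, 0 < ν ∧ (-1 : ℝ) ^ (w + rk F) * pp F ((Lc c1 ^ σ) a) (a W • ee W) =
      κ * ν * (a W * a W) := by
    intro W
    by_cases hW0 : a W = 0
    · exact ⟨1, one_pos, by simp [hW0]⟩
    · obtain ⟨hW, hWw⟩ := ha W hW0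
      have hm := rk_mono hW
      obtain ⟨ν, hν, e⟩ := f_sign (fun U hU => (ha U hU).2) (w - rk F) F W hW (by omega) hWw H
      refine ⟨ν, hν, ?_⟩
      rw [map_smul, h w a ha W hW (by omega), e, smul_eq_mul]
      have : (-1 : ℝ) ^ (w + rk F) * (-1) ^ (w - rk F) = 1 := by
        rw [← pow_add, show w + rk F + (w - rk F) = 2 * w by omega, pow_mul]; simp
      calc (-1 : ℝ) ^ (w + rk F) * (a W * (κ * ((-1) ^ (w - rk F) * ν * a W)))
          = ((-1 : ℝ) ^ (w + rk F) * (-1) ^ (w - rk F)) * (κ * ν * (a W * a W)) := by ring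
        _ = _ := by rw [this, one_mul]
  choose ν hν hν2 using hterm
  obtain ⟨W₀, hW₀⟩ : ∃ W, a W ≠ 0 := by
    by_contra! h'
    exact h0 (funext h')
  have e : (-1 : ℝ) ^ (w + rk F) * pp F ((Lc c1 ^ σ) a) a = ∑ W, κ * ν W * (a W * a W) := by
    have e0 : pp F ((Lc c1 ^ σ) a) a = ∑ W, pp F ((Lc c1 ^ σ) a) (a W • ee W) := by
      rw [← map_sum, ← eq_sum_ee a]
    rw [e0, Finset.mul_sum]
    exact Finset.sum_congr rfl fun W _ => hν2 W
  rw [e]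
  refine Finset.sum_pos' (fun W _ => ?_) ⟨W₀, Finset.mem_univ _, ?_⟩
  · exact mul_nonneg (mul_pos hκ (hν W)).le (mul_self_nonneg _)
  · exact mul_pos (mul_pos hκ (hν _)) (mul_self_pos.2 hW₀)

theorem ND0 (F : Submodule K V) (w : ℕ) : ∀ σ, 2 * w + σ = finrank K V + rk F → ∀ a ∈ AF F w,
    (∀ b ∈ AF F w, pp F ((Lc c1 ^ σ) a) b = 0) → a = 0 := by
  induction w with
  | zero =>
    intro σ hw a ha h
    by_contra h0
    have := prim_sign ha (fun X _ h => absurd h (by omega)) hw h0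
    rw [h a ha, mul_zero] at this
    exact lt_irrefl _ this
  | succ w ih =>
    intro σ hw a ha h
    obtain ⟨a₁, ha₁, y, rfl, H, hy⟩ := decomp F (w+1) a ha
    have hy' : ∃ b ∈ AF F w, y = Lc c1 b := by
      rcases hy with rfl | ⟨w', h1, b, hb, e⟩
      · exact ⟨0, zero_mem _, by simp⟩
      · obtain rfl : w' = w := by omega
        exact ⟨b, hb, e⟩
    obtain ⟨b, hb, rfl⟩ := hy'
    have hLb : Lc c1 b ∈ AF F (w+1) := Lc_mem hb
    have ha0 : a₁ = 0 := by
      by_contra h0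
      have hs := prim_sign ha₁ H hw h0
      have e := h a₁ ha₁
      rw [map_add, map_add, LinearMap.add_apply, ← Lpow_succ', pp_Lpow_symm _ _ hb ha₁,
        pp_symm F b, lowprim ha₁ H (by omega) (by omega) hb, add_zero] at e
      rw [e, mul_zero] at hs
      exact lt_irrefl _ hs
    subst ha0
    have : b = 0 := by
      refine ih (σ+2) (by omega) b hb fun b' hb' => ?_
      have := h (Lc c1 b') (Lc_mem hb')
      rw [zero_add, ← Lpow_succ', ← pp_Lc_symm _ (Lpow_mem _ hb) hb', ← Lpow_succ] at this
      exact this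
    rw [this]; simp

theorem HR0 (F : Submodule K V) : HR (K := K) AF c1 F := by
  intro w σ hw a ha hp h0
  obtain ⟨a₁, ha₁, y, rfl, H, hy⟩ := decomp F w a ha
  rcases hy with rfl | ⟨w', h1, b, hb, rfl⟩
  · rw [add_zero] at h0 ⊢
    exact prim_sign ha₁ H hw h0
  · have : b = 0 := by
      refine ND0 F w' (σ+2) (by omega) b hb fun u hu => ?_
      have := hp w' h1 u hu
      rw [map_add, map_add, LinearMap.add_apply, lowprim ha₁ H (by omega) (by omega) hu, zero_add,
        ← Lpow_succ'] at this
      exact this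
    subst this
    rw [map_zero, add_zero] at h0 ⊢
    exact prim_sign ha₁ H hw h0

end Init
end TopHeavy

namespace TopHeavy
open Module

section InitSys
variable {K V : Type} [Field K] [AddCommGroup V] [Module K V] [Finite V] [Fintype V]

/-- nondegeneracy on the low side -/
theorem nd_low (F : Submodule K V) (w w' : ℕ) (hw : w + w' = finrank K V + rk F) (hle : w ≤ w')
    (a : Submodule K V → ℝ) (ha : a ∈ AF F w) (h : ∀ b ∈ AF F w', pp F a b = 0) : a = 0 := by
  obtain ⟨σ, rfl⟩ := Nat.exists_eq_add_of_le hle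
  refine ND0 F w σ (by omega) a ha fun b hb => ?_
  rw [pp_Lpow_symm c1 σ ha hb]
  exact h _ (Lpow_mem σ hb)

theorem rk_comap_mkQ (F : Submodule K V) (X : Submodule K (V ⧸ F)) :
    finrank K (X.comap F.mkQ) = finrank K X + rk F := by
  have : FiniteDimensional K V := Module.Finite.of_finite
  have h := (F.mkQ.domRestrict (X.comap F.mkQ)).finrank_range_add_finrank_ker
  rw [LinearMap.range_domRestrict, Submodule.map_comap_eq_of_surjective (Submodule.mkQ_surjective F)] at h
  rw [← h]
  congr 1
  rw [LinearMap.ker_domRestrict, Submodule.ker_mkQ]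
  exact (LinearEquiv.finrank_eq (Submodule.comapSubtypeEquivOfLe (by
    intro x hx
    rw [Submodule.mem_comap, (Submodule.Quotient.mk_eq_zero F).2 hx |> fun e => (show F.mkQ x = 0 from e)]
    exact X.zero_mem)))

theorem exists_duality (F : Submodule K V) : ∃ δ : Submodule K V → Submodule K V,
    (∀ U, F ≤ δ U) ∧ (∀ U, F ≤ U → rk (δ U) + rk U = finrank K V + rk F) ∧
    (∀ U U', F ≤ U → F ≤ U' → δ U = δ U' → U = U') := by
  have : FiniteDimensional K V := Module.Finite.of_finite
  have hcm : ∀ U, F ≤ U → (U.map F.mkQ).comap F.mkQ = U := fun U hU => by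
    rw [Submodule.comap_map_mkQ, sup_eq_right.2 hU]
  let e : Dual K (V ⧸ F) ≃ₗ[K] (V ⧸ F) := LinearEquiv.ofFinrankEq _ _ Subspace.dual_finrank_eq
  refine ⟨fun U => (((U.map F.mkQ).dualAnnihilator).map (e : Dual K (V ⧸ F) →ₗ[K] (V ⧸ F))).comap F.mkQ,
    fun U => ?_, fun U hU => ?_, fun U U' hU hU' h => ?_⟩
  · intro x hx
    rw [Submodule.mem_comap, (show F.mkQ x = 0 from (Submodule.Quotient.mk_eq_zero F).2 hx)]
    exact Submodule.zero_mem _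
  · have h1 := rk_comap_mkQ F (((U.map F.mkQ).dualAnnihilator).map (e : Dual K (V ⧸ F) →ₗ[K] (V ⧸ F)))
    have h2 := rk_comap_mkQ F (U.map F.mkQ)
    rw [hcm U hU] at h2
    have h3 := Subspace.finrank_add_finrank_dualAnnihilator_eq (U.map F.mkQ)
    have h4 := LinearEquiv.finrank_map_eq e ((U.map F.mkQ).dualAnnihilator)
    have h5 := Submodule.finrank_quotient_add_finrank F
    unfold rk at *
    rw [h1]
    have h4' : finrank K ↥(((U.map F.mkQ).dualAnnihilator).map (e : Dual K (V ⧸ F) →ₗ[K] (V ⧸ F))) =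
      finrank K ↥((U.map F.mkQ).dualAnnihilator) := h4
    omega
  · have h1 := Submodule.comap_injective_of_surjective (Submodule.mkQ_surjective F) h
    have h2 := Submodule.map_injective_of_injective (f := (e : Dual K (V ⧸ F) →ₗ[K] (V ⧸ F))) e.injective h1
    have h3 := Subspace.dualAnnihilator_inj.1 h2
    rw [← hcm U hU, h3, hcm U' hU']

theorem finrank_AF_le (F : Submodule K V) (w w' : ℕ) (hw : w + w' = finrank K V + rk F) :
    finrank ℝ (AF F w) ≤ finrank ℝ (AF F w') := by
  classical
  obtain ⟨δ, h1, h2, h3⟩ := exists_duality F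
  let Φ : (Submodule K V → ℝ) →ₗ[ℝ] (Submodule K V → ℝ) :=
    ∑ U, (LinearMap.proj U : (Submodule K V → ℝ) →ₗ[ℝ] ℝ).smulRight (ee (δ U))
  have hΦ : ∀ a, Φ a = ∑ U, a U • ee (δ U) := fun a => by simp [Φ]
  have hm : ∀ a ∈ AF F w, Φ a ∈ AF F w' := by
    intro a ha
    rw [hΦ]
    refine Submodule.sum_mem _ fun U _ => ?_
    by_cases h0 : a U = 0
    · rw [h0, zero_smul]; exact Submodule.zero_mem _
    · have := ha U h0
      exact Submodule.smul_mem _ _ (ee_mem' (h1 U) (by have := h2 U this.1; omega))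
  refine LinearMap.finrank_le_finrank_of_injective (f := Φ.restrict hm) ?_
  rw [← LinearMap.ker_eq_bot, LinearMap.ker_eq_bot']
  rintro ⟨a, ha⟩ h0
  have h0' : Φ a = 0 := congrArg Subtype.val h0
  apply Subtype.ext
  funext U₀
  by_contra hU
  apply hU
  have := congrFun h0' (δ U₀)
  rw [hΦ, Finset.sum_apply, Finset.sum_eq_single U₀] at this
  · simpa [ee] using this
  · intro U _ hne
    by_cases h0 : a U = 0
    · simp [h0]
    · have : δ U₀ ≠ δ U := fun h => hne (h3 _ _ (ha _ hU).1 (ha _ h0).1 h).symm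
      simp [ee, Pi.single_apply, this]
  · simp

theorem nd_all (F : Submodule K V) (w w' : ℕ) (hw : w + w' = finrank K V + rk F)
    (a : Submodule K V → ℝ) (ha : a ∈ AF F w) (h : ∀ b ∈ AF F w', pp F a b = 0) : a = 0 := by
  rcases le_total w w' with hle | hle
  · exact nd_low F w w' hw hle a ha h
  let T : AF F w' →ₗ[ℝ] Dual ℝ (AF F w) :=
    ((pp F).compl₁₂ (AF F w').subtype (AF F w).subtype)
  have hT : ∀ b x, T b x = pp F b.1 x.1 := fun b x => rfl
  have hTi : Function.Injective T := by
    rw [← LinearMap.ker_eq_bot, LinearMap.ker_eq_bot']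
    intro b hb
    apply Subtype.ext
    refine nd_low F w' w (by omega) hle b.1 b.2 fun x hx => ?_
    rw [← hT b ⟨x, hx⟩, hb]; rfl
  have hfr : finrank ℝ (AF F w') = finrank ℝ (Dual ℝ (AF F w)) :=
    le_antisymm (LinearMap.finrank_le_finrank_of_injective hTi)
      (by rw [Subspace.dual_finrank_eq]; exact finrank_AF_le F w w' hw)
  have hTs := (LinearMap.injective_iff_surjective_of_finrank_eq_finrank hfr).1 hTi
  have : (⟨a, ha⟩ : AF F w) = 0 := by
    rw [← Module.forall_dual_apply_eq_zero_iff ℝ]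
    intro φ
    obtain ⟨b, rfl⟩ := hTs φ
    rw [hT, pp_symm]
    exact h _ b.2
  exact congrArg Subtype.val this

theorem inj_univ (F : Submodule K V) (w : ℕ) (hF : F ≠ ⊤) (hw : 2 * w ≤ finrank K V + rk F)
    (a : Submodule K V → ℝ) (ha : a ∈ AF F w) (h : ∀ s : V, mu s a = 0) : a = 0 := by
  have hlt := rk_lt hF
  obtain ⟨σ, hσ⟩ := Nat.exists_eq_add_of_le hw
  rcases σ with _ | σ
  · refine nd_all F w w (by omega) a ha fun b hb => ?_
    refine AF_induction (pp F a) 0 (fun W hW hWw => ?_) hb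
    obtain ⟨i, hiW, hiF⟩ : ∃ i, i ∈ W ∧ i ∉ F := by
      by_contra! hcon
      have := rk_mono (show W ≤ F from hcon)
      omega
    rw [pp_adj hiF ha (ee_mem (up_le hW hiW)), h i]
    simp
  · refine ND0 F w (σ+1) hσ.symm a ha fun b hb => ?_
    rw [Lpow_succ', Lc_apply]
    simp [h]

theorem lim_univ (F : Submodule K V) (w : ℕ) (hF : F ≠ ⊤) (g : V → (Submodule K V → ℝ))
    (h1 : ∀ s, s ∉ F → g s ∈ AF (TopHeavy.up F s) (w + 1))
    (h2 : ∀ s, s ∉ F → ∀ t, t ∉ F → TopHeavy.up F s = TopHeavy.up F t → g s = g t)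
    (h3 : ∀ s, s ∉ F → ∀ t, t ∉ F → mu t (g s) = mu s (g t)) :
    ∃ a ∈ AF F w, ∀ s, s ∉ F → mu s a = g s := by
  classical
  rcases le_or_gt (finrank K V) w with hD | hD
  · refine ⟨0, Submodule.zero_mem _, fun s hs => ?_⟩
    rw [map_zero, AF_eq_zero (Or.inr (by omega)) (h1 s hs)]
  obtain ⟨w', hw'⟩ := Nat.exists_eq_add_of_le (show w ≤ finrank K V + rk F by omega)
  have hindep : ∀ W, F ≤ W → ∀ i ∈ W, i ∉ F → ∀ j ∈ W, j ∉ F →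
      pp (up F i) (g i) (ee W) = pp (up F j) (g j) (ee W) := by
    intro W hW i hi hiF j hj hjF
    by_cases hji : j ∈ up F i
    · have e := up_eq_of_mem hjF hji
      rw [h2 i hiF j hjF (by first | exact e | exact e.symm)]
      first | rw [e] | rw [← e]
    · have hij := not_mem_up_iff hiF hji
      rw [pp_adj hji (h1 i hiF) (ee_mem (up_le (up_le hW hi) hj)),
        pp_adj hij.2 (h1 j hjF) (ee_mem (up_le (up_le hW hj) hi)), h3 i hiF j hjF, up_comm]
  let f : Submodule K V → ℝ := fun W => if h : ∃ i, i ∈ W ∧ i ∉ F then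
    pp (up F h.choose) (g h.choose) (ee W) else 0
  have hf : ∀ W, F ≤ W → ∀ i ∈ W, i ∉ F → f W = pp (up F i) (g i) (ee W) := by
    intro W hW i hi hiF
    have hex : ∃ i, i ∈ W ∧ i ∉ F := ⟨i, hi, hiF⟩
    simp only [f, dif_pos hex]
    exact hindep W hW _ hex.choose_spec.1 hex.choose_spec.2 i hi hiF
  obtain ⟨a, ha, hrep⟩ := represent (AF F w) (AF F w') (pp F) (nd_all F w w' hw'.symm)
    (fun b hb h => nd_all F w' w (by omega) b hb fun a ha => by rw [pp_symm]; exact h a ha) (dotp f)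
  refine ⟨a, ha, fun s hs => ?_⟩
  rw [← sub_eq_zero]
  have hmem := mu_mem s ha
  refine nd_all (up F s) (w+1) w' (by rw [rk_up hs]; omega) _ (Submodule.sub_mem _ hmem (h1 s hs))
    fun b hb => ?_
  rw [map_sub, LinearMap.sub_apply, sub_eq_zero, ← pp_adj hs ha hb, hrep b (AF_up_le _ _ _ hb)]
  refine AF_induction (dotp f) (pp (up F s) (g s)) (fun W hW _ => ?_) hb
  rw [dotp_ee, hf W ((le_up _ _).trans hW) s (hW (mem_up _ _)) hs]

theorem sys_univ : Sys (Finset.univ : Finset V) (AF (K := K)) where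
  sub F w := le_rfl
  up F w s _ := AF_up_le _ _ _
  mul F w s _ a ha := mu_mem s ha
  span := by simp
  one F := ee_mem le_rfl
  nd := nd_all
  inj F w hF hw a ha h := inj_univ F w hF hw a ha fun s => h s (Finset.mem_univ _)
  lim F w hF g h1 h2 h3 := by
    obtain ⟨a, ha, h⟩ := lim_univ F w hF g (fun s hs => h1 s (Finset.mem_univ _) hs)
      (fun s hs t ht => h2 s (Finset.mem_univ _) hs t (Finset.mem_univ _) ht)
      (fun s hs t ht => h3 s (Finset.mem_univ _) hs t (Finset.mem_univ _) ht)
    exact ⟨a, ha, fun s _ => h s⟩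
  hr := HR0

end InitSys
end TopHeavy

namespace TopHeavy
open Module

section Concl
variable {K V : Type} [Field K] [AddCommGroup V] [Module K V] [Finite V] [Fintype V]
variable {S : Finset V} {N : Submodule K V → ℕ → Submodule ℝ (Submodule K V → ℝ)}

/-- flats of the configuration `S` -/
def IsFl (S : Finset V) (F : Submodule K V) : Prop := Submodule.span K ((S : Set V) ∩ F) = F

theorem IsFl.up {F : Submodule K V} (hF : IsFl S F) {s : V} (hs : s ∈ S) : IsFl S (up F s) := by
  refine le_antisymm (Submodule.span_le.2 Set.inter_subset_right) ?_
  refine up_le ?_ (Submodule.subset_span ⟨hs, mem_up F s⟩)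
  conv_lhs => rw [← hF]
  exact Submodule.span_mono (Set.inter_subset_inter_right _ (le_up F s))

theorem N_span_le (hP : Pre S N) (w : ℕ) (T : Finset V) :
    T ⊆ S → N (Submodule.span K (T : Set V)) w ≤ N ⊥ w := by
  classical
  induction T using Finset.induction_on with
  | empty => intro _; simp
  | insert s T hs ih =>
    intro hT
    rw [Finset.insert_subset_iff] at hT
    refine le_trans ?_ (ih hT.2)
    have : Submodule.span K ((insert s T : Finset V) : Set V) = TopHeavy.up (Submodule.span K (T : Set V)) s := by
      rw [Finset.coe_insert, Submodule.span_insert, TopHeavy.up, sup_comm]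
    rw [this]
    exact hP.up _ _ _ hT.1

theorem ee_mem_bot (hS : Sys S N) {F : Submodule K V} (hF : IsFl S F) : ee F ∈ N ⊥ (rk F) := by
  classical
  have h := N_span_le (K := K) hS.toPre (rk F) (S.filter (· ∈ F)) (Finset.filter_subset _ _)
  have e : Submodule.span K ((S.filter (· ∈ F) : Finset V) : Set V) = F := by
    conv_rhs => rw [← hF]
    congr 1
    ext x; simp
  rw [e] at h
  exact h (hS.one F)

theorem hl_inj (hS : Sys S N) {k m : ℕ} (hk : 2 * k + m ≤ finrank K V) {a : Submodule K V → ℝ}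
    (ha : a ∈ N ⊥ k) (h : (Lc (ind S) ^ m) a = 0) : a = 0 := by
  obtain ⟨t, ht⟩ := Nat.exists_eq_add_of_le hk
  have h' : (Lc (ind S) ^ (m + t)) a = 0 := by
    rw [add_comm, pow_add, Module.End.mul_apply, h, map_zero]
  rcases hs : m + t with _ | σ
  · rw [hs] at h'; exact h'
  · rw [hs] at h'
    have hcS : ∀ v, ind S v ≠ 0 → v ∈ S := fun v hv => by
      by_contra hvS
      exact hv (by simp [ind, hvS])
    have hne : (⊥ : Submodule K V) ≠ ⊤ := by
      intro e
      have h1 := rk_bot (K := K) (V := V)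
      rw [e, rk_top] at h1
      omega
    refine HL (F := ⊥) (w := k) (σ := σ) hS.toPre (fun v => by unfold ind; split_ifs <;> norm_num) hcS
      (fun v _ _ => hS.hr _) (fun b hb hb0 => ?_) (by rw [rk_bot]; omega) ha
      (fun b _ => by rw [h']; simp)
    refine hS.inj ⊥ k hne (by rw [rk_bot]; omega) b hb fun s hs => hb0 s ?_
    simp [ind, hs]

theorem supp_Lpow {F : Submodule K V} (hF : IsFl S F) (m : ℕ) :
    ∀ G, ((Lc (ind S) ^ m) (ee F)) G ≠ 0 → IsFl S G ∧ F ≤ G ∧ rk G = rk F + m := by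
  classical
  let Q : ℕ → Submodule ℝ (Submodule K V → ℝ) := fun m =>
    { carrier := {a | ∀ G, a G ≠ 0 → IsFl S G ∧ F ≤ G ∧ rk G = rk F + m}
      zero_mem' := fun G h => absurd rfl h
      add_mem' := fun {a b} ha hb G h => by
        by_cases h0 : a G = 0
        · exact hb G fun h1 => h (by simp [h0, h1])
        · exact ha G h0
      smul_mem' := fun c a ha G h => ha G fun h0 => h (by simp [h0]) }
  have hee : ∀ m G, IsFl S G → F ≤ G → rk G = rk F + m → ee G ∈ Q m := by
    intro m G h1 h2 h3 G' h
    have : G' = G := by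
      by_contra hne
      exact h (by simp [ee, hne])
    subst this
    exact ⟨h1, h2, h3⟩
  suffices h : (Lc (ind S) ^ m) (ee F) ∈ Q m from h
  induction m with
  | zero => exact hee 0 F hF le_rfl rfl
  | succ m ih =>
    rw [Lpow_succ, Lc_apply]
    refine Submodule.sum_mem _ fun v _ => ?_
    by_cases hv : v ∈ S
    · refine Submodule.smul_mem _ _ ?_
      rw [eq_sum_ee ((Lc (ind S) ^ m) (ee F)), map_sum]
      refine Submodule.sum_mem _ fun G _ => ?_
      rw [map_smul]
      by_cases h0 : ((Lc (ind S) ^ m) (ee F)) G = 0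
      · rw [h0, zero_smul]; exact Submodule.zero_mem _
      refine Submodule.smul_mem _ _ ?_
      obtain ⟨h1, h2, h3⟩ := ih G h0
      by_cases hvG : v ∈ G
      · rw [mu_ee_mem hvG]; exact Submodule.zero_mem _
      · rw [mu_ee_not_mem hvG]
        exact hee _ _ (h1.up hv) (h2.trans (le_up _ _)) (by rw [rk_up hvG]; omega)
    · simp only [ind, hv, if_false, zero_smul]; exact Submodule.zero_mem _

theorem top_heavy_K (S : Finset V) (hspan : Submodule.span K (S : Set V) = ⊤) (r r' : ℕ)
    (hrr' : r ≤ r') (hsum : r + r' ≤ finrank K V) :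
    ∃ ι : {F : Submodule K V // IsFl S F ∧ rk F = r} → Submodule K V,
      Function.Injective ι ∧ ∀ F, F.1 ≤ ι F ∧ IsFl S (ι F) ∧ rk (ι F) = r' := by
  classical
  obtain ⟨N, hS⟩ := sys_down S hspan _ Finset.univ AF (Finset.subset_univ _) rfl (sys_univ (K := K))
  obtain ⟨m, rfl⟩ := Nat.exists_eq_add_of_le hrr'
  let t : {F : Submodule K V // IsFl S F ∧ rk F = r} → Finset (Submodule K V) := fun F =>
    Finset.univ.filter fun G => F.1 ≤ G ∧ IsFl S G ∧ rk G = r + m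
  have key := (Finset.all_card_le_biUnion_card_iff_exists_injective t).1 ?_
  · obtain ⟨ι, h1, h2⟩ := key
    exact ⟨ι, h1, fun F => by simpa [t] using h2 F⟩
  intro A
  let Ψ : (A → ℝ) →ₗ[ℝ] (Submodule K V → ℝ) :=
    ∑ F, (LinearMap.proj F : (A → ℝ) →ₗ[ℝ] ℝ).smulRight (ee F.1.1)
  have hΨ : ∀ c, Ψ c = ∑ F, c F • ee F.1.1 := fun c => by simp [Ψ]
  have hΨm : ∀ c, Ψ c ∈ N ⊥ r := fun c => by
    rw [hΨ]
    refine Submodule.sum_mem _ fun F _ => Submodule.smul_mem _ _ ?_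
    have := ee_mem_bot hS F.1.2.1
    rwa [F.1.2.2] at this
  have hΨ0 : ∀ c, Ψ c = 0 → c = 0 := by
    intro c hc
    funext F
    have := congrFun hc F.1.1
    rw [hΨ, Finset.sum_apply, Finset.sum_eq_single F] at this
    · simpa [ee] using this
    · intro F' _ hne
      have : F.1.1 ≠ F'.1.1 := fun h => hne (Subtype.ext (Subtype.ext h)).symm
      simp [ee, this]
    · simp
  let B : Finset (Submodule K V) := A.biUnion t
  let R : (A → ℝ) →ₗ[ℝ] (B → ℝ) :=
    (LinearMap.funLeft ℝ ℝ (fun G : B => G.1)) ∘ₗ (Lc (ind S) ^ m) ∘ₗ Ψ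
  have hR : Function.Injective R := by
    rw [← LinearMap.ker_eq_bot, LinearMap.ker_eq_bot']
    intro c hc
    apply hΨ0
    refine hl_inj hS (k := r) (m := m) (by omega) (hΨm c) ?_
    funext G
    by_cases hG : G ∈ B
    · exact congrFun hc ⟨G, hG⟩
    · rw [hΨ, map_sum, Finset.sum_apply]
      refine Finset.sum_eq_zero fun F _ => ?_
      rw [map_smul, Pi.smul_apply]
      by_contra h0
      have h1 : ((Lc (ind S) ^ m) (ee F.1.1)) G ≠ 0 := fun h => h0 (by rw [h, smul_zero])
      obtain ⟨h2, h3, h4⟩ := supp_Lpow F.1.2.1 m G h1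
      apply hG
      change G ∈ A.biUnion t
      rw [Finset.mem_biUnion]
      refine ⟨F.1, F.2, ?_⟩
      simp only [t, Finset.mem_filter, Finset.mem_univ, true_and]
      exact ⟨h3, h2, by rw [h4, F.1.2.2]⟩
  have := LinearMap.finrank_le_finrank_of_injective hR
  simpa using this

end Concl
end TopHeavy

namespace TopHeavy
open Module

section Matroid

theorem det_iff {L : Type} [Field L] {D : ℕ} (w : Fin D → (Fin D → L)) :
    (Matrix.of w).det ≠ 0 ↔ LinearIndependent L w := by
  rw [← isUnit_iff_ne_zero, ← Matrix.isUnit_iff_isUnit_det, ← Matrix.linearIndependent_rows_iff_isUnit]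
  rfl

theorem exists_basis_ext {L : Type} [Field L] {n D : ℕ} (v : Fin n → (Fin D → L))
    (hv : Submodule.span L (Set.range v) = ⊤) (T : Set (Fin n)) :
    ∃ b ⊆ T, finrank L (Submodule.span L (v '' T)) = b.ncard ∧
      ∃ f : Fin D → Fin n, b ⊆ Set.range f ∧ Function.Injective f ∧ LinearIndependent L (v ∘ f) := by
  obtain ⟨b, hbT, -, hsp, hb⟩ := exists_linearIndepOn_extension (K := L) (v := v) (s := ∅) (t := T)
    (linearIndepOn_empty L v) (Set.empty_subset _)
  obtain ⟨c, -, hbc, hspc, hc⟩ := exists_linearIndepOn_extension (K := L) hb (Set.subset_univ _)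
  have hcard : ∀ s : Set (Fin n), LinearIndepOn L v s →
      finrank L (Submodule.span L (v '' s)) = s.ncard := by
    intro s hs
    classical
    have := finrank_span_eq_card (R := L) (b := fun x : s => v x) hs
    rw [← Set.image_eq_range] at this
    rw [this, ← Nat.card_eq_fintype_card, Nat.card_coe_set_eq]
  refine ⟨b, hbT, ?_, ?_⟩
  · rw [← hcard b hb]
    rw [le_antisymm (Submodule.span_le.2 hsp) (Submodule.span_mono (Set.image_mono hbT))]
  · have hctop : Submodule.span L (v '' c) = ⊤ := by
      rw [eq_top_iff, ← hv]
      refine Submodule.span_le.2 ?_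
      rwa [Set.image_univ] at hspc
    have hcD : c.ncard = D := by
      rw [← hcard c hc, hctop, finrank_top]; simp
    have : Nat.card c = D := by rw [Nat.card_coe_set_eq, hcD]
    let e : Fin D ≃ c := (Finite.equivFinOfCardEq this).symm
    refine ⟨fun i => (e i).1, fun x hx => ⟨e.symm ⟨x, hbc hx⟩, by simp⟩,
      Subtype.val_injective.comp e.injective, ?_⟩
    exact LinearIndependent.comp hc e e.injective

theorem exists_det {L : Type} [Field L] {n D : ℕ} (v : Fin n → (Fin D → L))
    (hv : Submodule.span L (Set.range v) = ⊤) :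
    ∃ f : Fin D → Fin n, (Matrix.of (v ∘ f)).det ≠ 0 := by
  obtain ⟨b, -, -, f, -, -, h⟩ := exists_basis_ext v hv ∅
  exact ⟨f, (det_iff _).2 h⟩

theorem span_of_det {L : Type} [Field L] {n D : ℕ} (v : Fin n → (Fin D → L)) (f : Fin D → Fin n)
    (hf : (Matrix.of (v ∘ f)).det ≠ 0) : Submodule.span L (Set.range v) = ⊤ := by
  have h := ((det_iff _).1 hf).span_eq_top_of_card_eq_finrank' (by simp)
  rw [eq_top_iff, ← h]
  exact Submodule.span_mono (Set.range_comp_subset_range f v)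

theorem rank_le {L K : Type} [Field L] [Field K] {n D : ℕ} (v : Fin n → (Fin D → L))
    (u : Fin n → (Fin D → K)) (hv : Submodule.span L (Set.range v) = ⊤)
    (h : ∀ f : Fin D → Fin n, (Matrix.of (v ∘ f)).det ≠ 0 → (Matrix.of (u ∘ f)).det ≠ 0)
    (T : Set (Fin n)) :
    finrank L (Submodule.span L (v '' T)) ≤ finrank K (Submodule.span K (u '' T)) := by
  obtain ⟨b, hbT, hr, f, hbf, hfi, hf⟩ := exists_basis_ext v hv T
  have hu := (det_iff _).1 (h f ((det_iff _).2 hf))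
  have hub : LinearIndepOn K u b := by
    have : LinearIndepOn K u (Set.range f) := by
      have := (linearIndepOn_range_iff hfi u).2 hu
      exact this
    exact this.mono hbf
  rw [hr]
  classical
  have := finrank_span_eq_card (R := K) (b := fun x : b => u x) hub
  rw [← Set.image_eq_range, ← Nat.card_eq_fintype_card, Nat.card_coe_set_eq] at this
  rw [← this]
  exact Submodule.finrank_mono (Submodule.span_mono (Set.image_mono hbT))

theorem rank_eq {L K : Type} [Field L] [Field K] {n D : ℕ} (v : Fin n → (Fin D → L))
    (u : Fin n → (Fin D → K)) (hv : Submodule.span L (Set.range v) = ⊤)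
    (h : ∀ f : Fin D → Fin n, (Matrix.of (v ∘ f)).det ≠ 0 ↔ (Matrix.of (u ∘ f)).det ≠ 0)
    (T : Set (Fin n)) :
    finrank L (Submodule.span L (v '' T)) = finrank K (Submodule.span K (u '' T)) := by
  obtain ⟨f, hf⟩ := exists_det v hv
  exact le_antisymm (rank_le v u hv (fun f => (h f).1) T)
    (rank_le u v (span_of_det u f ((h f).1 hf)) (fun f => (h f).2) T)

theorem mem_span_iff_rank {L : Type} [Field L] {n D : ℕ} (v : Fin n → (Fin D → L)) (T : Set (Fin n))
    (i : Fin n) : v i ∈ Submodule.span L (v '' T) ↔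
      finrank L (Submodule.span L (v '' (insert i T))) = finrank L (Submodule.span L (v '' T)) := by
  have hle : Submodule.span L (v '' T) ≤ Submodule.span L (v '' (insert i T)) :=
    Submodule.span_mono (Set.image_mono (Set.subset_insert _ _))
  constructor
  · intro hi
    rw [Set.image_insert_eq, Submodule.span_insert_eq_span hi]
  · intro h
    rw [Submodule.eq_of_le_of_finrank_eq hle h.symm]
    exact Submodule.subset_span ⟨i, Set.mem_insert _ _, rfl⟩

theorem mem_span_iff {L K : Type} [Field L] [Field K] {n D : ℕ} (v : Fin n → (Fin D → L))
    (u : Fin n → (Fin D → K)) (hv : Submodule.span L (Set.range v) = ⊤)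
    (h : ∀ f : Fin D → Fin n, (Matrix.of (v ∘ f)).det ≠ 0 ↔ (Matrix.of (u ∘ f)).det ≠ 0)
    (T : Set (Fin n)) (i : Fin n) :
    v i ∈ Submodule.span L (v '' T) ↔ u i ∈ Submodule.span K (u '' T) := by
  rw [mem_span_iff_rank, mem_span_iff_rank, rank_eq v u hv h, rank_eq v u hv h]

end Matroid

section Reduce

theorem jac_int : IsJacobsonRing ℤ := by
  rw [isJacobsonRing_iff_prime_eq]
  intro P hP
  by_cases h0 : P = ⊥
  · subst h0
    rw [eq_bot_iff]
    intro x hx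
    rw [Ideal.mem_jacobson_bot] at hx
    have := hx (3 * x)
    rw [Int.isUnit_iff] at this
    rw [Ideal.mem_bot]
    rcases this with h | h
    · have : x * x = 0 := by linarith
      exact mul_self_eq_zero.1 this
    · nlinarith [mul_self_nonneg x]
  · have := hP.isMaximal h0
    exact Ideal.jacobson_eq_self_of_isMaximal

theorem finite_of_ft0 (K : Type) [Field K] [Algebra.FiniteType ℤ K] : Finite K := by
  have : IsJacobsonRing ℤ := jac_int
  have hfin : Module.Finite ℤ K := finite_of_finite_type_of_isJacobsonRing ℤ K
  apply Module.finite_of_fg_torsion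
  have hni : ¬ Function.Injective (algebraMap ℤ K) := fun hi =>
    Int.not_isField (isField_of_isIntegral_of_isField hi (Field.toIsField K))
  rw [injective_iff_map_eq_zero] at hni
  push Not at hni
  obtain ⟨a, ha, ha0⟩ := hni
  intro x
  refine ⟨⟨a, mem_nonZeroDivisors_of_ne_zero ha0⟩, ?_⟩
  change a • x = 0
  rw [Algebra.smul_def, ha, zero_mul]

theorem finite_of_ft (K : Type) [Field K] [inst : Algebra ℤ K] [hft : Algebra.FiniteType ℤ K] :
    Finite K := by
  have e : inst = Ring.toIntAlgebra K := Subsingleton.elim _ _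
  subst e
  exact finite_of_ft0 K

theorem exists_reduction {n D : ℕ} (v : Fin n → (Fin D → ℝ)) :
    ∃ (K : Type) (_ : Field K) (_ : Finite K) (u : Fin n → (Fin D → K)),
      ∀ f : Fin D → Fin n, (Matrix.of (v ∘ f)).det ≠ 0 ↔ (Matrix.of (u ∘ f)).det ≠ 0 := by
  classical
  let X : Set ℝ := Set.range (fun p : Fin n × Fin D => v p.1 p.2) ∪
    Set.range (fun f : Fin D → Fin n => ((Matrix.of (v ∘ f)).det)⁻¹)
  have hX : X.Finite := (Set.finite_range _).union (Set.finite_range _)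
  let A := Algebra.adjoin ℤ X
  have : Algebra.FiniteType ℤ A := Algebra.FiniteType.adjoin_of_finite hX
  obtain ⟨m, hm⟩ := Ideal.exists_maximal A
  let _ : Field (A ⧸ m) := Ideal.Quotient.field m
  have hft : Algebra.FiniteType ℤ (A ⧸ m) := inferInstance
  let vA : Fin n → Fin D → A := fun i j => ⟨v i j, Algebra.subset_adjoin (Or.inl ⟨(i, j), rfl⟩)⟩
  let q : A →+* (A ⧸ m) := Ideal.Quotient.mk m
  let s : A →+* ℝ := A.toSubring.subtype
  have hs : Function.Injective s := Subtype.val_injective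
  refine ⟨A ⧸ m, inferInstance, @finite_of_ft _ _ _ hft, fun i j => q (vA i j), fun f => ?_⟩
  have e1 : (Matrix.of (v ∘ f)).det = s (Matrix.of (vA ∘ f)).det := by
    rw [RingHom.map_det]; rfl
  have e2 : (Matrix.of ((fun i j => q (vA i j)) ∘ f)).det = q (Matrix.of (vA ∘ f)).det := by
    rw [RingHom.map_det]; rfl
  rw [e2]
  constructor
  · intro h h0
    have hmem : ((Matrix.of (v ∘ f)).det)⁻¹ ∈ A := Algebra.subset_adjoin (Or.inr ⟨f, rfl⟩)
    have hmul : (Matrix.of (vA ∘ f)).det * ⟨_, hmem⟩ = 1 := by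
      apply hs
      rw [map_mul, ← e1, map_one]
      exact mul_inv_cancel₀ h
    have := congrArg q hmul
    rw [map_mul, h0, zero_mul, map_one] at this
    exact zero_ne_one this
  · intro h h0
    apply h
    rw [e1] at h0
    rw [(map_eq_zero_iff s hs).1 h0, map_zero]

end Reduce
end TopHeavy

namespace TopHeavy
open Module

section Affine
variable {n d : ℕ}

/-- the linear embedding of `ℝᵈ` at height `0` -/
def cz : (Fin d → ℝ) →ₗ[ℝ] (Fin (d+1) → ℝ) where
  toFun x := Fin.cons 0 x
  map_add' x y := by
    funext i
    refine Fin.cases ?_ (fun j => ?_) i <;> simp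
  map_smul' c x := by
    funext i
    refine Fin.cases ?_ (fun j => ?_) i <;> simp

/-- lift to height `1` -/
def lft (x : Fin d → ℝ) : Fin (d+1) → ℝ := Fin.cons 1 x

theorem lft_sub (x y : Fin d → ℝ) : lft x = lft y + cz (x - y) := by
  funext i
  refine Fin.cases ?_ (fun j => ?_) i <;> simp [lft, cz]

theorem cz_inj : Function.Injective (cz (d := d)) := fun x y h => by
  funext j
  have := congrFun h j.succ
  simpa [cz] using this

theorem span_lft (s : Set (Fin d → ℝ)) (p : Fin d → ℝ) (hp : p ∈ s) :
    Submodule.span ℝ (lft '' s) =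
      (affineSpan ℝ s).direction.map cz ⊔ Submodule.span ℝ {lft p} := by
  rw [direction_affineSpan]
  refine le_antisymm (Submodule.span_le.2 ?_) (sup_le ?_ ?_)
  · rintro _ ⟨x, hx, rfl⟩
    rw [lft_sub x p]
    refine Submodule.add_mem _ (Submodule.mem_sup_right (Submodule.mem_span_singleton_self _))
      (Submodule.mem_sup_left (Submodule.mem_map_of_mem (vsub_mem_vectorSpan ℝ hx hp)))
  · rw [vectorSpan_eq_span_vsub_set_right ℝ hp, Submodule.map_span_le]
    rintro _ ⟨x, hx, rfl⟩
    have : cz (x -ᵥ p) = lft x - lft p := by rw [lft_sub x p]; simp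
    change cz (x -ᵥ p) ∈ _
    rw [this]
    exact Submodule.sub_mem _ (Submodule.subset_span ⟨x, hx, rfl⟩) (Submodule.subset_span ⟨p, hp, rfl⟩)
  · rw [Submodule.span_singleton_le_iff_mem]
    exact Submodule.subset_span ⟨p, hp, rfl⟩

theorem mem_lft (s : Set (Fin d → ℝ)) (hs : s.Nonempty) (x : Fin d → ℝ) :
    lft x ∈ Submodule.span ℝ (lft '' s) ↔ x ∈ affineSpan ℝ s := by
  obtain ⟨p, hp⟩ := hs
  have hpm : p ∈ affineSpan ℝ s := subset_affineSpan ℝ s hp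
  rw [span_lft s p hp, Submodule.mem_sup]
  constructor
  · rintro ⟨_, ⟨y, hy, rfl⟩, z, hz, h⟩
    obtain ⟨c, rfl⟩ := Submodule.mem_span_singleton.1 hz
    have hc : c = 1 := by simpa [lft, cz] using congrFun h 0
    subst hc
    have hx : x = y +ᵥ p := by
      funext j
      have := congrFun h j.succ
      simpa [lft, cz] using this.symm
    rw [hx]
    exact AffineSubspace.vadd_mem_of_mem_direction hy hpm
  · intro hx
    refine ⟨cz (x - p), Submodule.mem_map_of_mem (AffineSubspace.vsub_mem_direction hx hpm), lft p,
      Submodule.mem_span_singleton_self _, ?_⟩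
    rw [lft_sub x p]
    exact add_comm _ _

theorem rank_lft (s : Set (Fin d → ℝ)) (hs : s.Nonempty) :
    finrank ℝ (Submodule.span ℝ (lft '' s)) = flatRank (affineSpan ℝ s) := by
  obtain ⟨p, hp⟩ := hs
  have hne : lft p ≠ 0 := fun h => by
    have := congrFun h 0
    simp [lft] at this
  have h := Submodule.finrank_sup_add_finrank_inf_eq
    ((affineSpan ℝ s).direction.map (cz (d := d))) (Submodule.span ℝ {lft p})
  have hinf : (affineSpan ℝ s).direction.map (cz (d := d)) ⊓ Submodule.span ℝ {lft p} = ⊥ := by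
    rw [eq_bot_iff]
    rintro _ ⟨⟨y, hy, rfl⟩, hz⟩
    obtain ⟨c, hc⟩ := Submodule.mem_span_singleton.1 hz
    have : c = 0 := by simpa [lft, cz] using congrFun hc 0
    rw [Submodule.mem_bot, ← hc, this, zero_smul]
  rw [← span_lft s p hp, hinf, finrank_bot, finrank_span_singleton hne,
    ← (Submodule.equivMapOfInjective cz cz_inj _).finrank_eq] at h
  exact h

end Affine
end TopHeavy

theorem top_heavy_matching_points {n d : ℕ} (hd : 1 ≤ d) (P : Fin n → (Fin d → ℝ))
    (hspan : affineSpan ℝ (Set.range P) = ⊤)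
    (r r' : ℕ) (hr : 1 ≤ r) (hrr' : r ≤ r') (hsum : r + r' ≤ d + 1) :
    ∃ ι : {W : AffineSubspace ℝ (Fin d → ℝ) // IsFlatOf P W ∧ flatRank W = r} →
          {W : AffineSubspace ℝ (Fin d → ℝ) // IsFlatOf P W ∧ flatRank W = r'},
      Function.Injective ι ∧
        ∀ F, F.1 ≤ (ι F).1 := by
  classical
  let v : Fin n → (Fin (d+1) → ℝ) := fun i => TopHeavy.lft (P i)
  have himg : ∀ T : Set (Fin n), TopHeavy.lft '' (P '' T) = v '' T := fun T => by
    rw [Set.image_image]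
  have hne0 : (Set.range P).Nonempty := by
    rw [← affineSpan_nonempty ℝ, hspan]
    exact ⟨0, trivial⟩
  have hv : Submodule.span ℝ (Set.range v) = ⊤ := by
    have h1 := TopHeavy.rank_lft (Set.range P) hne0
    rw [hspan, ← Set.image_univ, himg, Set.image_univ] at h1
    apply Submodule.eq_top_of_finrank_eq
    rw [h1, flatRank, AffineSubspace.direction_top, finrank_top]
    simp
  obtain ⟨K, _, _, u, hu⟩ := TopHeavy.exists_reduction v
  have hu0 : Submodule.span K (Set.range u) = ⊤ := by
    obtain ⟨f, hf⟩ := TopHeavy.exists_det v hv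
    exact TopHeavy.span_of_det u f ((hu f).1 hf)
  have hmem : ∀ T : Set (Fin n), T.Nonempty → ∀ i,
      (P i ∈ affineSpan ℝ (P '' T) ↔ u i ∈ Submodule.span K (u '' T)) := by
    intro T hT i
    rw [← TopHeavy.mem_lft _ (hT.image P), himg]
    exact TopHeavy.mem_span_iff v u hv hu T i
  have hrank : ∀ T : Set (Fin n), T.Nonempty →
      flatRank (affineSpan ℝ (P '' T)) = TopHeavy.rk (Submodule.span K (u '' T)) := by
    intro T hT
    rw [← TopHeavy.rank_lft _ (hT.image P), himg]
    exact TopHeavy.rank_eq v u hv hu T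
  let _ : Fintype (Fin (d+1) → K) := Fintype.ofFinite _
  let S : Finset (Fin (d+1) → K) := Finset.univ.image u
  have hScoe : (S : Set (Fin (d+1) → K)) = Set.range u := by simp [S]
  obtain ⟨κ, hκi, hκ⟩ := TopHeavy.top_heavy_K (K := K) S (by rw [hScoe, hu0]) r r' hrr'
    (by simpa using hsum)
  -- index sets
  let TW : AffineSubspace ℝ (Fin d → ℝ) → Set (Fin n) := fun W => {i | P i ∈ W}
  let TG : Submodule K (Fin (d+1) → K) → Set (Fin n) := fun G => {i | u i ∈ G}
  have hTWimg : ∀ W, P '' (TW W) = Set.range P ∩ (W : Set (Fin d → ℝ)) := by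
    intro W
    ext x
    constructor
    · rintro ⟨i, hi, rfl⟩
      exact ⟨⟨i, rfl⟩, hi⟩
    · rintro ⟨⟨i, rfl⟩, hi⟩
      exact ⟨i, hi, rfl⟩
  have hTGimg : ∀ G, u '' (TG G) = (S : Set (Fin (d+1) → K)) ∩ G := by
    intro G
    rw [hScoe]
    ext x
    constructor
    · rintro ⟨i, hi, rfl⟩
      exact ⟨⟨i, rfl⟩, hi⟩
    · rintro ⟨⟨i, rfl⟩, hi⟩
      exact ⟨i, hi, rfl⟩
  have hW : ∀ W, IsFlatOf P W → affineSpan ℝ (P '' TW W) = W ∧ (TW W).Nonempty := by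
    intro W hW
    have e : affineSpan ℝ (P '' TW W) = W := by rw [hTWimg]; exact hW.2.symm
    refine ⟨e, ?_⟩
    have := hW.1
    rw [← e, affineSpan_nonempty] at this
    exact Set.image_nonempty.1 this
  have hG : ∀ G, TopHeavy.IsFl S G → Submodule.span K (u '' TG G) = G := by
    intro G hG
    rw [hTGimg]; exact hG
  -- real flats to flats over `K`
  have hΦ : ∀ W, IsFlatOf P W → flatRank W = r →
      TopHeavy.IsFl S (Submodule.span K (u '' TW W)) ∧ TopHeavy.rk (Submodule.span K (u '' TW W)) = r := by
    intro W h1 h2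
    obtain ⟨e, hne⟩ := hW W h1
    refine ⟨le_antisymm (Submodule.span_le.2 Set.inter_subset_right) ?_, ?_⟩
    · refine Submodule.span_le.2 ?_
      rintro _ ⟨i, hi, rfl⟩
      refine Submodule.subset_span ⟨?_, Submodule.subset_span ⟨i, hi, rfl⟩⟩
      rw [hScoe]; exact ⟨i, rfl⟩
    · rw [← hrank _ hne, e, h2]
  have hΦi : ∀ W W', IsFlatOf P W → IsFlatOf P W' →
      Submodule.span K (u '' TW W) = Submodule.span K (u '' TW W') → W = W' := by
    intro W W' h1 h1' he
    obtain ⟨e, hne⟩ := hW W h1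
    obtain ⟨e', hne'⟩ := hW W' h1'
    have : TW W = TW W' := by
      ext i
      change P i ∈ W ↔ P i ∈ W'
      rw [← e, ← e', hmem _ hne, hmem _ hne', he]
    rw [← e, ← e', this]
  -- and back
  have hTGne : ∀ G, TopHeavy.IsFl S G → TopHeavy.rk G = r' → (TG G).Nonempty := by
    intro G h1 h2
    by_contra h
    rw [Set.not_nonempty_iff_eq_empty] at h
    have e := hG G h1
    rw [h, Set.image_empty, Submodule.span_empty] at e
    rw [← e, TopHeavy.rk_bot] at h2
    omega
  have hΨ : ∀ G, TopHeavy.IsFl S G → TopHeavy.rk G = r' →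
      IsFlatOf P (affineSpan ℝ (P '' TG G)) ∧ flatRank (affineSpan ℝ (P '' TG G)) = r' := by
    intro G h1 h2
    have hne := hTGne G h1 h2
    refine ⟨⟨(affineSpan_nonempty ℝ).2 (hne.image P), le_antisymm ?_ ?_⟩, ?_⟩
    · refine affineSpan_mono ℝ ?_
      rintro _ ⟨i, hi, rfl⟩
      exact ⟨⟨i, rfl⟩, subset_affineSpan ℝ _ ⟨i, hi, rfl⟩⟩
    · exact affineSpan_le.2 Set.inter_subset_right
    · rw [hrank _ hne, hG G h1, h2]
  have hΨi : ∀ G G', TopHeavy.IsFl S G → TopHeavy.rk G = r' → TopHeavy.IsFl S G' →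
      TopHeavy.rk G' = r' → affineSpan ℝ (P '' TG G) = affineSpan ℝ (P '' TG G') → G = G' := by
    intro G G' h1 h2 h1' h2' he
    have hcl : ∀ H, TopHeavy.IsFl S H → TopHeavy.rk H = r' → ∀ i,
        (P i ∈ affineSpan ℝ (P '' TG H) ↔ u i ∈ H) := by
      intro H a b i
      rw [hmem _ (hTGne H a b), hG H a]
    have : TG G = TG G' := by
      ext i
      change u i ∈ G ↔ u i ∈ G'
      rw [← hcl G h1 h2, ← hcl G' h1' h2', he]
    rw [← hG G h1, ← hG G' h1', this]
  let Φ : {W : AffineSubspace ℝ (Fin d → ℝ) // IsFlatOf P W ∧ flatRank W = r} →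
      {F : Submodule K (Fin (d+1) → K) // TopHeavy.IsFl S F ∧ TopHeavy.rk F = r} :=
    fun W => ⟨Submodule.span K (u '' TW W.1), hΦ W.1 W.2.1 W.2.2⟩
  refine ⟨fun W => ⟨affineSpan ℝ (P '' TG (κ (Φ W))), hΨ _ (hκ (Φ W)).2.1 (hκ (Φ W)).2.2⟩, ?_, ?_⟩
  · intro W W' h
    have h1 := hΨi _ _ (hκ (Φ W)).2.1 (hκ (Φ W)).2.2 (hκ (Φ W')).2.1 (hκ (Φ W')).2.2
      (congrArg Subtype.val h)
    have h2 := congrArg Subtype.val (hκi h1)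
    exact Subtype.ext (hΦi _ _ W.2.1 W'.2.1 h2)
  · intro W
    change W.1 ≤ affineSpan ℝ (P '' TG (κ (Φ W)))
    conv_lhs => rw [← (hW W.1 W.2.1).1]
    refine affineSpan_mono ℝ (Set.image_mono fun i hi => ?_)
    exact (hκ (Φ W)).1 (Submodule.subset_span ⟨i, hi, rfl⟩)
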